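/- arXiv:2102.01546 — 4 statements merged into one kernel-verified Lean document; each statement's English description precedes it below -/
import Mathlib

section
/- Let X be a real Banach space, M ⊆ X and ε ≥ 0. If M is ε-weakly precompact, then the absolutely convex hull aco(M) of M (the convex balanced hull, i.e., the set of all sums ∑ a_i x_i with x_i ∈ M and ∑ |a_i| ≤ 1) is 2ε-weakly precompact. -/
open Filter Topology

/-- `δ((x_n)) ≤ ε`: for every functional in the closed unit ball of the dual,
`limsup x*(x_n) − liminf x*(x_n) ≤ ε`. -/
def DeltaLE {E : Type*} [NormedAddCommGroup E] [NormedSpace ℝ E] (x : ℕ → E) (ε : ℝ) : Prop :=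
  ∀ f : E →L[ℝ] ℝ, ‖f‖ ≤ 1 →
    Filter.limsup (fun n => f (x n)) Filter.atTop
      - Filter.liminf (fun n => f (x n)) Filter.atTop ≤ ε

/-- A set `M` is `ε`-weakly precompact if it is bounded and every sequence in `M`
admits a subsequence `(x_{n_k})` with `δ((x_{n_k})) ≤ ε`. -/
def IsWeaklyPrecompactWith {E : Type*} [NormedAddCommGroup E] [NormedSpace ℝ E]
    (ε : ℝ) (M : Set E) : Prop :=
  Bornology.IsBounded M ∧
    ∀ x : ℕ → E, (∀ n, x n ∈ M) →
      ∃ φ : ℕ → ℕ, StrictMono φ ∧ DeltaLE (fun k => x (φ k)) ε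

/-- The absolutely convex hull of `M`: all sums `∑ aᵢ xᵢ` with `xᵢ ∈ M` and `∑ |aᵢ| ≤ 1`. -/
def acoHull {E : Type*} [NormedAddCommGroup E] [NormedSpace ℝ E] (M : Set E) : Set E :=
  {y | ∃ (m : ℕ) (a : ℕ → ℝ) (x : ℕ → E),
    (∀ i < m, x i ∈ M) ∧ (∑ i ∈ Finset.range m, |a i|) ≤ 1 ∧
    y = ∑ i ∈ Finset.range m, a i • x i}

theorem wpc_diag (P : ℕ → Set ℕ → Prop) (M : Set ℕ) (hM : M.Infinite)
    (hmono : ∀ n M M', (M' \ M).Finite → P n M → P n M')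
    (hex : ∀ n M', M' ⊆ M → M'.Infinite → ∃ M'' ⊆ M', M''.Infinite ∧ P n M'') :
    ∃ N ⊆ M, N.Infinite ∧ ∀ n, P n N := by
  choose! g hg1 hg2 hg3 using hex
  let s : ℕ → Set ℕ := fun k => Nat.rec M (fun n t => g n t) k
  have hs0 : s 0 = M := rfl
  have hsS : ∀ n, s (n + 1) = g n (s n) := fun n => rfl
  have hs : ∀ n, s n ⊆ M ∧ (s n).Infinite := by
    intro n
    induction n with
    | zero => exact ⟨subset_rfl, hM⟩
    | succ n ih => exact ⟨(hg1 n _ ih.1 ih.2).trans ih.1, hg2 n _ ih.1 ih.2⟩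
  have hanti : Antitone s := antitone_nat_of_succ_le fun n => hg1 n _ (hs n).1 (hs n).2
  obtain ⟨φ, hφ, hφs⟩ := extraction_forall_of_frequently (P := fun n k => k ∈ s n)
    (fun n => Nat.frequently_atTop_iff_infinite.2 (hs n).2)
  refine ⟨Set.range φ, ?_, Set.infinite_range_of_injective hφ.injective, fun n => ?_⟩
  · rintro _ ⟨n, rfl⟩
    exact (hs n).1 (hφs n)
  · refine hmono n (s (n + 1)) _ ?_ (hg3 n _ (hs n).1 (hs n).2)
    refine ((Set.finite_Iio (n + 1)).image φ).subset ?_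
    rintro _ ⟨⟨k, rfl⟩, hk⟩
    refine ⟨k, ?_, rfl⟩
    by_contra hk'
    exact hk (hanti (not_lt.1 hk') (hφs k))

def WpcDiv {S : Type*} (E : Bool → ℕ → Set S) (M : Set ℕ) (x : S) : Prop :=
  ∀ b, {n | n ∈ M ∧ x ∈ E b n}.Infinite

def WpcBad {S : Type*} (E : Bool → ℕ → Set S) (C : Set S) (M : Set ℕ) : Prop :=
  ∀ M' ⊆ M, M'.Infinite → ∃ x ∈ C, WpcDiv E M' x

theorem WpcDiv.mono {S : Type*} {E : Bool → ℕ → Set S} {M M' : Set ℕ} {x : S}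
    (h : WpcDiv E M' x) (hf : (M' \ M).Finite) : WpcDiv E M x := by
  intro b hfin
  apply h b
  refine (hf.union hfin).subset ?_
  rintro n ⟨hn, hx⟩
  by_cases hnM : n ∈ M
  · exact Or.inr ⟨hnM, hx⟩
  · exact Or.inl ⟨hn, hnM⟩

theorem WpcBad.mono {S : Type*} {E : Bool → ℕ → Set S} {C : Set S} {M M' : Set ℕ}
    (h : WpcBad E C M) (hM : M' ⊆ M) : WpcBad E C M' :=
  fun N hN hi => h N (hN.trans hM) hi

theorem wpc_step {S T : Type*} [Finite T] (E : Bool → ℕ → Set S) (C : T → Set S)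
    (M : Set ℕ) (hM : M.Infinite) (hbad : ∀ t, WpcBad E (C t) M) :
    ∃ n ∈ M, ∃ M' ⊆ M, M'.Infinite ∧ ∀ t b, WpcBad E (C t ∩ E b n) M' := by
  by_contra! h
  obtain ⟨N, hNM, hN, hP⟩ := wpc_diag
    (fun n M' => n ∈ M → ∃ tb : T × Bool, ∀ x ∈ C tb.1 ∩ E tb.2 n, ¬ WpcDiv E M' x) M hM
    (by
      intro n M1 M2 hf h1 hn
      obtain ⟨tb, htb⟩ := h1 hn
      exact ⟨tb, fun x hx hd => htb x hx (hd.mono hf)⟩)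
    (by
      intro n M' hM' hi
      by_cases hn : n ∈ M
      · obtain ⟨t, b, hb⟩ := h n hn M' hM' hi
        simp only [WpcBad] at hb
        push Not at hb
        obtain ⟨M'', h1, h2, h3⟩ := hb
        exact ⟨M'', h1, h2, fun _ => ⟨(t, b), h3⟩⟩
      · exact ⟨M', subset_rfl, hi, fun h => absurd h hn⟩)
  have hP' : ∀ n : N, ∃ tb : T × Bool, ∀ x ∈ C tb.1 ∩ E tb.2 n, ¬ WpcDiv E N x :=
    fun n => hP n (hNM n.2)
  choose f hf using hP'
  have : Infinite N := hN.to_subtype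
  obtain ⟨tb, htb⟩ := Finite.exists_infinite_fiber f
  have hinf : (Subtype.val '' (f ⁻¹' {tb})).Infinite :=
    (Set.infinite_coe_iff.1 htb).image Subtype.val_injective.injOn
  set N' : Set ℕ := Subtype.val '' (f ⁻¹' {tb}) with hN'
  have hN'N : N' ⊆ N := by
    rintro _ ⟨n, _, rfl⟩
    exact n.2
  obtain ⟨x, hxC, hx⟩ := hbad tb.1 N' (hN'N.trans hNM) hinf
  obtain ⟨n, ⟨⟨n', hn', rfl⟩, hxn⟩⟩ := (hx tb.2).nonempty
  have hn'' : f n' = tb := hn'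
  refine hf n' x ?_ (hx.mono ?_)
  · rw [hn'']
    exact ⟨hxC, hxn⟩
  · rw [Set.sdiff_eq_empty.2 hN'N]
    exact Set.finite_empty

theorem wpc_tree {S : Type*} (E : Bool → ℕ → Set S)
    (M : Set ℕ) (hM : M.Infinite) (hbad : WpcBad E Set.univ M) :
    ∃ s : ℕ → Finset ℕ, Monotone s ∧ (∀ k, (s k).card = k) ∧ (∀ k, (s k : Set ℕ) ⊆ M) ∧
      ∀ k, ∀ U : Finset ℕ, ∃ x, ∀ n ∈ s k, x ∈ E (decide (n ∈ U)) n := by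
  classical
  let D : Finset ℕ → Finset ℕ → Set S := fun s U => {x | ∀ n ∈ s, x ∈ E (decide (n ∈ U)) n}
  let Q : Finset ℕ × Set ℕ → Prop := fun p =>
    (p.1 : Set ℕ) ⊆ M ∧ p.2 ⊆ M ∧ p.2.Infinite ∧ ∀ U, WpcBad E (D p.1 U) p.2
  have key : ∀ p, Q p → ∃ q, Q q ∧ p.1 ⊆ q.1 ∧ q.1.card = p.1.card + 1 := by
    rintro ⟨s, L⟩ ⟨h1, h2, h3, h4⟩
    obtain ⟨n, hn, L', hL', hi, hb⟩ := wpc_step E (fun t : s.powerset => D s t.1) (L \ s)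
      (h3.sdiff s.finite_toSet) (fun t => (h4 t.1).mono Set.sdiff_subset)
    have hns : n ∉ s := fun h => hn.2 h
    refine ⟨(insert n s, L'), ⟨?_, (hL'.trans Set.sdiff_subset).trans h2, hi, fun U => ?_⟩,
      Finset.subset_insert _ _, Finset.card_insert_of_notMem hns⟩
    · simp only [Finset.coe_insert]
      exact Set.insert_subset (h2 hn.1) h1
    · intro M' hM' hM'i
      obtain ⟨x, ⟨hx1, hx2⟩, hx⟩ := hb ⟨U ∩ s, by simp⟩ (decide (n ∈ U)) M' hM' hM'i
      refine ⟨x, ?_, hx⟩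
      intro m hm
      rcases Finset.mem_insert.1 hm with rfl | hm
      · exact hx2
      · have := hx1 m hm
        simpa [hm] using this
  choose! g hg1 hg2 hg3 using key
  let p : ℕ → Finset ℕ × Set ℕ := fun k => Nat.rec (∅, M) (fun _ q => g q) k
  have hp : ∀ k, Q (p k) := by
    intro k
    induction k with
    | zero =>
      refine ⟨by simp [p], subset_rfl, hM, fun U => ?_⟩
      intro M' h1 h2
      obtain ⟨x, _, hx⟩ := hbad M' h1 h2
      exact ⟨x, by simp [D, p], hx⟩
    | succ k ih => exact hg1 _ ih
  refine ⟨fun k => (p k).1, monotone_nat_of_le_succ fun k => hg2 _ (hp k), fun k => ?_,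
    fun k => (hp k).1, fun k U => ?_⟩
  · induction k with
    | zero => rfl
    | succ k ih => exact (hg3 _ (hp k)).trans (by rw [ih])
  · obtain ⟨x, hx, _⟩ := (hp k).2.2.2 U _ subset_rfl (hp k).2.2.1
    exact ⟨x, hx⟩

def wpcChi (n : ℕ) (U : Finset ℕ) : ℝ := if n ∈ U then 1 else -1

theorem wpcChi_sq (n : ℕ) (U : Finset ℕ) : wpcChi n U * wpcChi n U = 1 := by
  unfold wpcChi; split_ifs <;> norm_num

theorem wpcChi_orth (s : Finset ℕ) (i j : ℕ) (hi : i ∈ s) (hij : i ≠ j) :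
    ∑ U ∈ s.powerset, wpcChi i U * wpcChi j U = 0 := by
  classical
  have h : ∑ U ∈ s.powerset, wpcChi i U * wpcChi j U
      = ∑ U ∈ s.powerset, -(wpcChi i U * wpcChi j U) := by
    refine Finset.sum_nbij' (fun U => symmDiff U {i}) (fun U => symmDiff U {i}) ?_ ?_ ?_ ?_ ?_
    · intro U hU
      simp only [Finset.mem_powerset] at hU ⊢
      intro a ha
      simp only [Finset.mem_symmDiff, Finset.mem_singleton] at ha
      grind
    · intro U hU
      simp only [Finset.mem_powerset] at hU ⊢
      intro a ha
      simp only [Finset.mem_symmDiff, Finset.mem_singleton] at ha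
      grind
    · intro U _; simp
    · intro U _; simp
    · intro U _
      have h1 : wpcChi i (symmDiff U {i}) = - wpcChi i U := by
        unfold wpcChi
        by_cases h : i ∈ U <;> simp [Finset.mem_symmDiff, h]
      have h2 : wpcChi j (symmDiff U {i}) = wpcChi j U := by
        unfold wpcChi
        by_cases h : j ∈ U <;> simp [Finset.mem_symmDiff, h, hij.symm]
      rw [h1, h2]; ring
  rw [Finset.sum_neg_distrib] at h
  linarith

theorem wpcChi_sum_sq (s S : Finset ℕ) (hS : S ⊆ s) :
    ∑ U ∈ s.powerset, (∑ n ∈ S, wpcChi n U) ^ 2 = 2 ^ s.card * S.card := by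
  simp_rw [sq, Finset.sum_mul_sum]
  rw [Finset.sum_comm]
  have : ∀ i ∈ S, ∑ U ∈ s.powerset, ∑ j ∈ S, wpcChi i U * wpcChi j U = 2 ^ s.card := by
    intro i hi
    rw [Finset.sum_comm, Finset.sum_eq_single i]
    · simp [wpcChi_sq]
    · intro j _ hj
      exact wpcChi_orth s i j (hS hi) hj.symm
    · exact fun h => absurd hi h
  rw [Finset.sum_congr rfl this]
  simp [mul_comm]

theorem wpc_avg {K : Type*} (s S : Finset ℕ) (hS : S ⊆ s) (y : ℕ → K → ℝ) (z : K → ℝ)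
    (p : Finset ℕ → K) (a b C : ℝ) (m : ℕ) (hm : 0 < m) (hcard : S.card = m ^ 2)
    (hz : ∀ x, |z x - (a + b) / 2| ≤ C)
    (hp1 : ∀ U, ∀ n ∈ s, n ∈ U → b ≤ y n (p U))
    (hp2 : ∀ U, ∀ n ∈ s, n ∉ U → y n (p U) ≤ a) :
    (2 : ℝ) ^ s.card * ((m : ℝ) ^ 2 * ((b - a) / 2) - C * m) ≤
      ∑ U ∈ s.powerset, ∑ n ∈ S, |y n (p U) - z (p U)| := by
  have hm' : (0 : ℝ) < m := by exact_mod_cast hm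
  have h1 : ∀ U ∈ s.powerset, (m : ℝ) ^ 2 * ((b - a) / 2)
      - C * (((∑ n ∈ S, wpcChi n U) ^ 2 / m + m) / 2) ≤ ∑ n ∈ S, |y n (p U) - z (p U)| := by
    intro U _
    have hC : 0 ≤ C := (abs_nonneg _).trans (hz (p U))
    have h2 : ∀ n ∈ S, (b - a) / 2 - wpcChi n U * (z (p U) - (a + b) / 2)
        ≤ |y n (p U) - z (p U)| := by
      intro n hn
      by_cases hU : n ∈ U
      · have := hp1 U n (hS hn) hU
        have h3 := le_abs_self (y n (p U) - z (p U))
        simp only [wpcChi, hU, if_true]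
        linarith
      · have := hp2 U n (hS hn) hU
        have h3 := neg_abs_le (y n (p U) - z (p U))
        simp only [wpcChi, hU, if_false]
        linarith
    have h3 := Finset.sum_le_sum h2
    rw [Finset.sum_sub_distrib, ← Finset.sum_mul, Finset.sum_const, hcard, nsmul_eq_mul] at h3
    push_cast at h3
    set f := ∑ n ∈ S, wpcChi n U
    have h4 : f * (z (p U) - (a + b) / 2) ≤ C * |f| := by
      calc f * (z (p U) - (a + b) / 2) ≤ |f * (z (p U) - (a + b) / 2)| := le_abs_self _
        _ = |z (p U) - (a + b) / 2| * |f| := by rw [abs_mul, mul_comm]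
        _ ≤ C * |f| := by gcongr; exact hz _
    have h5 : |f| ≤ (f ^ 2 / m + m) / 2 := by
      rw [← sq_abs f]
      have : (|f| ^ 2 / m + m) / 2 - |f| = (|f| - m) ^ 2 / (2 * m) := by
        field_simp; ring
      have h6 : 0 ≤ (|f| - m) ^ 2 / (2 * m) := by positivity
      linarith
    have := mul_le_mul_of_nonneg_left h5 hC
    linarith
  refine le_trans (le_of_eq ?_) (Finset.sum_le_sum h1)
  rw [Finset.sum_sub_distrib, Finset.sum_const, ← Finset.mul_sum, ← Finset.sum_div, Finset.sum_add_distrib,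
    ← Finset.sum_div, wpcChi_sum_sq s S hS, hcard]
  simp only [Finset.sum_const, Finset.card_powerset, nsmul_eq_mul]
  push_cast
  field_simp
  ring

open MeasureTheory in
theorem wpc_measure {K : Type*} [TopologicalSpace K] [CompactSpace K] [T2Space K]
    [MeasurableSpace K] [BorelSpace K] (y : ℕ → C(K, ℝ)) (a b : ℝ)
    (s : ℕ → Finset ℕ) (hs : Monotone s) (p : ℕ → Finset ℕ → K)
    (hp1 : ∀ k U, ∀ n ∈ s k, n ∈ U → b ≤ y n (p k U))
    (hp2 : ∀ k U, ∀ n ∈ s k, n ∉ U → y n (p k U) ≤ a) :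
    ∃ ν : Measure K, IsProbabilityMeasure ν ∧
      ∀ (z : C(K, ℝ)) (C : ℝ) (m : ℕ) (S : Finset ℕ) (k : ℕ), 0 < m → S.card = m ^ 2 → S ⊆ s k →
        (∀ x, |z x - (a + b) / 2| ≤ C) →
        (m : ℝ) ^ 2 * ((b - a) / 2) - C * m ≤ ∑ n ∈ S, ∫ x, |y n x - z x| ∂ν := by
  let μ : ℕ → Measure K := fun k =>
    ((2 : ENNReal) ^ (s k).card)⁻¹ • ∑ U ∈ (s k).powerset, Measure.dirac (p k U)
  have hμ : ∀ k, IsProbabilityMeasure (μ k) := by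
    intro k
    constructor
    simp only [μ, Measure.smul_apply, Measure.finsetSum_apply, measure_univ, Finset.sum_const,
      Finset.card_powerset, smul_eq_mul, nsmul_eq_mul]
    push_cast
    rw [mul_one]
    exact ENNReal.inv_mul_cancel (by positivity) (by finiteness)
  have hint : ∀ (k : ℕ) (g : C(K, ℝ)),
      ∫ x, g x ∂(μ k) = ((2 : ℝ) ^ (s k).card)⁻¹ * ∑ U ∈ (s k).powerset, g (p k U) := by
    intro k g
    simp only [μ]
    rw [integral_smul_measure, integral_finsetSum_measure]
    · simp
    · intro U _
      exact g.continuous.integrable_of_hasCompactSupport (HasCompactSupport.of_compactSpace _)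
  let P : ℕ → ProbabilityMeasure K := fun k => ⟨μ k, hμ k⟩
  let u : Ultrafilter (ProbabilityMeasure K) := (hyperfilter ℕ).map P
  obtain ⟨ν, -, hν⟩ := isCompact_univ.ultrafilter_le_nhds u (by simp)
  have hT : Tendsto P (hyperfilter ℕ) (𝓝 ν) := hν
  rw [ProbabilityMeasure.tendsto_iff_forall_integral_tendsto] at hT
  refine ⟨ν, inferInstance, ?_⟩
  intro z C m S k hm hcard hS hz
  let G : C(K, ℝ) := ⟨fun x => ∑ n ∈ S, |y n x - z x|, by fun_prop⟩
  have hG := hT (BoundedContinuousFunction.mkOfCompact G)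
  have hrew : ∑ n ∈ S, ∫ x, |y n x - z x| ∂(ν : Measure K) = ∫ x, G x ∂(ν : Measure K) := by
    simp only [G, ContinuousMap.coe_mk]
    rw [integral_finsetSum]
    intro n _
    exact Continuous.integrable_of_hasCompactSupport (by fun_prop)
      (HasCompactSupport.of_compactSpace _)
  rw [hrew]
  refine ge_of_tendsto hG ?_
  have hev : ∀ᶠ j in atTop, k ≤ j := eventually_ge_atTop k
  filter_upwards [Nat.hyperfilter_le_atTop hev] with j hj
  change _ ≤ ∫ x, G x ∂(μ j)
  rw [hint]
  have := wpc_avg (s j) S (hS.trans (hs hj)) (fun n => y n) z (p j) a b C m hm hcard hz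
    (hp1 j) (hp2 j)
  rw [inv_mul_eq_div, le_div_iff₀ (by positivity), mul_comm]
  exact this

abbrev WpcK (X : Type*) [NormedAddCommGroup X] [NormedSpace ℝ X] : Type _ :=
  ↥((WeakDual.toStrongDual ⁻¹' Metric.closedBall (0 : StrongDual ℝ X) 1 : Set (WeakDual ℝ X)))

instance wpcK_compact (X : Type*) [NormedAddCommGroup X] [NormedSpace ℝ X] :
    CompactSpace (WpcK X) :=
  isCompact_iff_compactSpace.1 (WeakDual.isCompact_closedBall _ _)

noncomputable instance wpcK_meas (X : Type*) [NormedAddCommGroup X] [NormedSpace ℝ X] :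
    MeasurableSpace (WpcK X) := borel _

instance wpcK_borel (X : Type*) [NormedAddCommGroup X] [NormedSpace ℝ X] :
    BorelSpace (WpcK X) := ⟨rfl⟩

noncomputable def wpcEv {X : Type*} [NormedAddCommGroup X] [NormedSpace ℝ X] (x : X) : C(WpcK X, ℝ) :=
  ⟨fun f => f.1 x, (WeakDual.eval_continuous x).comp continuous_subtype_val⟩

noncomputable def wpcFun {X : Type*} [NormedAddCommGroup X] [NormedSpace ℝ X] (f : WpcK X) : X →L[ℝ] ℝ :=
  WeakDual.toStrongDual f.1

theorem wpcFun_norm {X : Type*} [NormedAddCommGroup X] [NormedSpace ℝ X] (f : WpcK X) :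
    ‖wpcFun f‖ ≤ 1 := by
  have h := f.2
  exact mem_closedBall_zero_iff.1 h

theorem wpcEv_apply {X : Type*} [NormedAddCommGroup X] [NormedSpace ℝ X] (x : X) (f : WpcK X) :
    wpcEv x f = wpcFun f x := rfl

theorem wpcEv_le {X : Type*} [NormedAddCommGroup X] [NormedSpace ℝ X] (x : X) (f : WpcK X) :
    |wpcEv x f| ≤ ‖x‖ := by
  rw [wpcEv_apply, ← Real.norm_eq_abs]
  exact ((wpcFun f).le_opNorm x).trans
    (mul_le_of_le_one_left (norm_nonneg _) (wpcFun_norm f))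

open MeasureTheory in
noncomputable def wpcD {X : Type*} [NormedAddCommGroup X] [NormedSpace ℝ X]
    (ν : Measure (WpcK X)) (x : X) : ℝ := ∫ f, |wpcEv x f| ∂ν

section
open MeasureTheory
variable {X : Type*} [NormedAddCommGroup X] [NormedSpace ℝ X]
  (ν : Measure (WpcK X)) [IsProbabilityMeasure ν]

theorem wpc_int (g : WpcK X → ℝ) (hg : Continuous g) : Integrable g ν :=
  hg.integrable_of_hasCompactSupport (HasCompactSupport.of_compactSpace _)

theorem wpcD_le_norm (x : X) : wpcD ν x ≤ ‖x‖ := by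
  unfold wpcD
  calc ∫ f, |wpcEv x f| ∂ν ≤ ∫ _, ‖x‖ ∂ν :=
        integral_mono (wpc_int ν _ (by fun_prop)) (integrable_const _) (fun f => wpcEv_le x f)
    _ = ‖x‖ := by simp

theorem wpcD_add (x y : X) : wpcD ν (x + y) ≤ wpcD ν x + wpcD ν y := by
  unfold wpcD
  rw [← integral_add (wpc_int ν _ (by fun_prop)) (wpc_int ν _ (by fun_prop))]
  refine integral_mono (wpc_int ν _ (by fun_prop)) (wpc_int ν _ (by fun_prop)) (fun f => ?_)
  simp only [wpcEv_apply, map_add]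
  exact abs_add_le _ _

theorem wpcD_smul (c : ℝ) (x : X) : wpcD ν (c • x) = |c| * wpcD ν x := by
  unfold wpcD
  rw [← integral_const_mul]
  simp only [wpcEv_apply, map_smul, smul_eq_mul, abs_mul]

theorem wpcD_zero : wpcD ν (0 : X) = 0 := by
  unfold wpcD
  simp [wpcEv_apply]

theorem wpcD_sum (m : ℕ) (a : ℕ → ℝ) (x : ℕ → X) :
    wpcD ν (∑ i ∈ Finset.range m, a i • x i) ≤ ∑ i ∈ Finset.range m, |a i| * wpcD ν (x i) := by
  induction m with
  | zero => simp [wpcD_zero]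
  | succ m ih =>
    rw [Finset.sum_range_succ, Finset.sum_range_succ]
    refine (wpcD_add ν _ _).trans ?_
    rw [wpcD_smul]
    linarith

theorem wpc_bdd (x : ℕ → X) (R : ℝ) (hx : ∀ n, ‖x n‖ ≤ R) (f : X →L[ℝ] ℝ) (hf : ‖f‖ ≤ 1) (n : ℕ) :
    |f (x n)| ≤ R := by
  rw [← Real.norm_eq_abs]
  exact (f.le_opNorm _).trans ((mul_le_of_le_one_left (norm_nonneg _) hf).trans (hx n))

theorem wpc_bddAbove {u : ℕ → ℝ} {R : ℝ} (h : ∀ n, |u n| ≤ R) :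
    IsBoundedUnder (· ≤ ·) atTop u ∧ IsBoundedUnder (· ≥ ·) atTop u :=
  ⟨isBoundedUnder_of ⟨R, fun n => (abs_le.1 (h n)).2⟩,
    isBoundedUnder_of ⟨-R, fun n => (abs_le.1 (h n)).1⟩⟩

theorem wpcD_consecutive (x : ℕ → X) (R ε : ℝ) (hx : ∀ n, ‖x n‖ ≤ R) (hδ : DeltaLE x ε)
    (η : ℝ) (hη : 0 < η) : ∃ n, wpcD ν (x (n + 1) - x n) < ε + η := by
  have hT : Tendsto (fun n => ∫ f, max (|wpcEv (x (n + 1) - x n) f| - ε) 0 ∂ν) atTop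
      (𝓝 (∫ _, (0 : ℝ) ∂ν)) := by
    refine tendsto_integral_of_dominated_convergence (fun _ => 2 * R + |ε|) ?_ ?_ ?_ ?_
    · intro n
      exact (wpc_int ν _ (by fun_prop)).aestronglyMeasurable
    · exact integrable_const _
    · intro n
      refine ae_of_all _ fun f => ?_
      have h1 := wpcEv_le (x (n + 1) - x n) f
      have h2 := norm_sub_le (x (n + 1)) (x n)
      have h3 := hx n
      have h4 := hx (n + 1)
      have h5 := neg_abs_le ε
      have h6 := abs_nonneg ε
      have h7 := norm_nonneg (x n)
      rw [Real.norm_of_nonneg (le_max_right _ _)]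
      apply max_le <;> linarith
    · refine ae_of_all _ fun f => ?_
      have hf := wpcFun_norm f
      have hb := wpc_bddAbove (wpc_bdd x R hx (wpcFun f) hf)
      have hd := hδ (wpcFun f) hf
      rw [Metric.tendsto_atTop]
      intro t ht
      have e1 := eventually_lt_of_limsup_lt (f := atTop) (u := fun n => wpcFun f (x n))
        (b := limsup (fun n => wpcFun f (x n)) atTop + t / 3) (by linarith) hb.1
      have e2 := eventually_lt_of_lt_liminf (f := atTop) (u := fun n => wpcFun f (x n))
        (b := liminf (fun n => wpcFun f (x n)) atTop - t / 3) (by linarith) hb.2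
      obtain ⟨N, hN⟩ := eventually_atTop.1 (e1.and e2)
      refine ⟨N, fun n hn => ?_⟩
      have h1 := hN n hn
      have h2 := hN (n + 1) (by omega)
      rw [Real.dist_eq, sub_zero, abs_of_nonneg (le_max_right _ _), wpcEv_apply, map_sub]
      apply max_lt _ ht
      have : |wpcFun f (x (n + 1)) - wpcFun f (x n)| < ε + t := by
        rw [abs_lt]
        constructor <;> linarith [h1.1, h1.2, h2.1, h2.2]
      linarith
  rw [integral_zero] at hT
  obtain ⟨n, hn⟩ := (hT.eventually (gt_mem_nhds hη)).exists
  refine ⟨n, lt_of_le_of_lt ?_ (by linarith : ε + ∫ f, max (|wpcEv (x (n + 1) - x n) f| - ε) 0 ∂ν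
    < ε + η)⟩
  unfold wpcD
  calc ∫ f, |wpcEv (x (n + 1) - x n) f| ∂ν
      ≤ ∫ f, (ε + max (|wpcEv (x (n + 1) - x n) f| - ε) 0) ∂ν := by
        refine integral_mono (wpc_int ν _ (by fun_prop)) (wpc_int ν _ (by fun_prop)) (fun f => ?_)
        have := le_max_left (|wpcEv (x (n + 1) - x n) f| - ε) 0
        simp only
        linarith
    _ = ε + ∫ f, max (|wpcEv (x (n + 1) - x n) f| - ε) 0 ∂ν := by
        rw [integral_add (integrable_const _) (wpc_int ν _ (by fun_prop))]
        simp

theorem wpcD_sub_comm (x y : X) : wpcD ν (x - y) = wpcD ν (y - x) := by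
  have := wpcD_smul ν (-1) (y - x)
  simpa using this

theorem wpc_cover (M : Set X) (ε : ℝ) (hM : IsWeaklyPrecompactWith ε M) (η : ℝ) (hη : 0 < η) :
    ∃ F : Finset X, ∀ x ∈ M, ∃ y ∈ F, wpcD ν (x - y) ≤ ε + η := by
  by_contra! h
  obtain ⟨x, hxM, hx⟩ := exists_seq_of_forall_finset_exists (fun x => x ∈ M)
    (fun x y => ε + η < wpcD ν (y - x)) (fun s _ => h s)
  obtain ⟨φ, hφ, hδ⟩ := hM.2 x hxM
  obtain ⟨R, hR⟩ := hM.1.exists_norm_le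
  obtain ⟨n, hn⟩ := wpcD_consecutive ν (fun k => x (φ k)) R ε (fun n => hR _ (hxM _)) hδ η hη
  exact absurd hn (not_lt.2 (hx _ _ (hφ (Nat.lt_succ_self n))).le)

theorem wpc_approx (M : Set X) (ε : ℝ) (hε : 0 ≤ ε) (hM : IsWeaklyPrecompactWith ε M) (η : ℝ)
    (hη : 0 < η) :
    ∃ Q : Set X, IsCompact Q ∧ ∀ y ∈ acoHull M, ∃ z ∈ Q, wpcD ν (y - z) ≤ ε + η := by
  classical
  obtain ⟨F, hF⟩ := wpc_cover ν M ε hM η hη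
  let Φ : (F → ℝ) → X := fun c => ∑ f : F, c f • (f : X)
  have hΦ : Continuous Φ := by fun_prop
  refine ⟨Φ '' (Set.univ.pi fun _ => Set.Icc (-1) 1),
    (isCompact_univ_pi fun _ => isCompact_Icc).image hΦ, ?_⟩
  rintro y ⟨m, a, x, hx, ha, rfl⟩
  choose! g hgF hg using hF
  refine ⟨∑ i ∈ Finset.range m, a i • g (x i), ?_, ?_⟩
  · refine ⟨fun f => ∑ i ∈ Finset.range m with g (x i) = f, a i, ?_, ?_⟩
    · intro f _
      rw [← abs_le.trans (Set.mem_Icc.symm)]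
      refine (Finset.abs_sum_le_sum_abs _ _).trans (le_trans ?_ ha)
      exact Finset.sum_le_sum_of_subset_of_nonneg (Finset.filter_subset _ _)
        (fun _ _ _ => abs_nonneg _)
    · simp only [Φ]
      rw [Finset.sum_coe_sort F
        (fun f => (∑ i ∈ Finset.range m with g (x i) = f, a i) • f)]
      rw [← Finset.sum_fiberwise_of_maps_to (s := Finset.range m) (t := F)
        (g := fun i => g (x i)) (fun i hi => hgF _ (hx i (Finset.mem_range.1 hi)))]
      refine Finset.sum_congr rfl fun f _ => ?_
      rw [Finset.sum_smul]
      refine Finset.sum_congr rfl fun i hi => ?_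
      rw [(Finset.mem_filter.1 hi).2]
  · rw [← Finset.sum_sub_distrib]
    simp_rw [← smul_sub]
    refine (wpcD_sum ν m a (fun i => x i - g (x i))).trans ?_
    calc ∑ i ∈ Finset.range m, |a i| * wpcD ν (x i - g (x i))
        ≤ ∑ i ∈ Finset.range m, |a i| * (ε + η) := by
          refine Finset.sum_le_sum fun i hi => ?_
          exact mul_le_mul_of_nonneg_left (hg _ (hx i (Finset.mem_range.1 hi))) (abs_nonneg _)
      _ = (∑ i ∈ Finset.range m, |a i|) * (ε + η) := by rw [Finset.sum_mul]
      _ ≤ ε + η := mul_le_of_le_one_left (by linarith) ha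
end

theorem wpc_contra {X : Type*} [NormedAddCommGroup X] [NormedSpace ℝ X]
    (M : Set X) (ε : ℝ) (hε : 0 ≤ ε)
    (hM : IsWeaklyPrecompactWith ε M) (y : ℕ → X) (hy : ∀ n, y n ∈ acoHull M) (a b : ℝ)
    (hab : 2 * ε < b - a) (s : ℕ → Finset ℕ) (hs : Monotone s) (hcard : ∀ k, (s k).card = k)
    (p : ℕ → Finset ℕ → WpcK X)
    (hp1 : ∀ k U, ∀ n ∈ s k, n ∈ U → b ≤ wpcEv (y n) (p k U))
    (hp2 : ∀ k U, ∀ n ∈ s k, n ∉ U → wpcEv (y n) (p k U) ≤ a) : False := by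
  classical
  obtain ⟨ν, hν, H⟩ := wpc_measure (fun n => wpcEv (y n)) a b s hs p hp1 hp2
  set η := (b - a - 2 * ε) / 8 with hηdef
  have hη : 0 < η := by rw [hηdef]; linarith
  obtain ⟨Q, hQ, hyQ⟩ := wpc_approx ν M ε hε hM η hη
  have hNinf : {n | ∃ k, n ∈ s k}.Infinite := by
    intro hfin
    have h1 : s (hfin.toFinset.card + 1) ⊆ hfin.toFinset := by
      intro n hn
      simpa using ⟨_, hn⟩
    have h2 := Finset.card_le_card h1
    rw [hcard] at h2
    omega
  choose z hzQ hz using fun n => hyQ (y n) (hy n)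
  obtain ⟨ψ, hψ, hψN⟩ := extraction_of_frequently_atTop
    (Nat.frequently_atTop_iff_infinite.2 hNinf)
  obtain ⟨w, hwQ, φ, hφ, hw⟩ := hQ.tendsto_subseq (fun n => hzQ (ψ n))
  obtain ⟨k0, hk0⟩ := Metric.tendsto_atTop.1 hw η hη
  choose! κ hκ using hψN
  have hbound : ∀ m : ℕ, 0 < m → (m : ℝ) * η ≤ ‖w‖ + |(a + b) / 2| := by
    intro m hm
    have hinj : Function.Injective (fun i => ψ (φ (k0 + i))) := by
      intro i j hij
      have := (hψ.comp hφ).injective hij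
      omega
    let S : Finset ℕ := (Finset.range (m ^ 2)).image (fun i => ψ (φ (k0 + i)))
    have hScard : S.card = m ^ 2 := by
      rw [Finset.card_image_of_injective _ hinj, Finset.card_range]
    have hS : S ⊆ s ((Finset.range (m ^ 2)).sup (fun i => κ (φ (k0 + i)))) := by
      intro n hn
      obtain ⟨i, hi, rfl⟩ := Finset.mem_image.1 hn
      exact hs (Finset.le_sup (f := fun i => κ (φ (k0 + i))) hi) (hκ _)
    have h1 := H (wpcEv w) (‖w‖ + |(a + b) / 2|) m S _ hm hScard hS (by
      intro x
      exact (abs_sub _ _).trans (by linarith [wpcEv_le w x]))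
    have h2 : ∀ n ∈ S, ∫ x, |wpcEv (y n) x - wpcEv w x| ∂ν ≤ ε + 2 * η := by
      intro n hn
      obtain ⟨i, hi, rfl⟩ := Finset.mem_image.1 hn
      have h3 : ∀ v : X, ∫ x, |wpcEv v x - wpcEv w x| ∂ν = wpcD ν (v - w) := by
        intro v
        simp only [wpcD, wpcEv_apply, map_sub]
      rw [h3]
      set n := ψ (φ (k0 + i)) with hn'
      have h4 : y n - w = (y n - z n) + (z n - w) := by abel
      rw [h4]
      refine (wpcD_add ν _ _).trans ?_
      have h5 := hz n
      have h6 := wpcD_le_norm ν (z n - w)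
      have h7 := hk0 (k0 + i) (by omega)
      rw [dist_eq_norm] at h7
      simp only [Function.comp_apply, ← hn'] at h7
      linarith
    have h3 := h1.trans (Finset.sum_le_sum h2)
    rw [Finset.sum_const, hScard, nsmul_eq_mul] at h3
    push_cast at h3
    have hm' : (0 : ℝ) < m := by exact_mod_cast hm
    have h4 : (b - a) / 2 = ε + 4 * η := by rw [hηdef]; ring
    rw [h4] at h3
    have h5 : (m : ℝ) * (m * η) ≤ m * (‖w‖ + |(a + b) / 2|) := by
      have : 0 ≤ (m : ℝ) * (m * η) := by positivity
      nlinarith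
    exact le_of_mul_le_mul_left h5 hm'
  obtain ⟨m, hm⟩ := exists_nat_gt ((‖w‖ + |(a + b) / 2|) / η)
  have hm0 : 0 < m := by
    have : (0 : ℝ) ≤ (‖w‖ + |(a + b) / 2|) / η := by positivity
    exact_mod_cast this.trans_lt hm
  have := hbound m hm0
  rw [div_lt_iff₀ hη] at hm
  linarith

theorem wpc_bounded {X : Type*} [NormedAddCommGroup X] [NormedSpace ℝ X]
    (M : Set X) (R : ℝ) (hR : ∀ x ∈ M, ‖x‖ ≤ R) (hR0 : 0 ≤ R) : ∀ y ∈ acoHull M, ‖y‖ ≤ R := by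
  rintro y ⟨m, a, x, hx, ha, rfl⟩
  calc ‖∑ i ∈ Finset.range m, a i • x i‖ ≤ ∑ i ∈ Finset.range m, ‖a i • x i‖ := norm_sum_le _ _
    _ ≤ ∑ i ∈ Finset.range m, |a i| * R := by
        refine Finset.sum_le_sum fun i hi => ?_
        rw [norm_smul, Real.norm_eq_abs]
        exact mul_le_mul_of_nonneg_left (hR _ (hx i (Finset.mem_range.1 hi))) (abs_nonneg _)
    _ = (∑ i ∈ Finset.range m, |a i|) * R := by rw [Finset.sum_mul]
    _ ≤ R := mul_le_of_le_one_left hR0 ha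

theorem acoHull_weaklyPrecompact
    {X : Type*} [NormedAddCommGroup X] [NormedSpace ℝ X] [CompleteSpace X]
    (M : Set X) (ε : ℝ) (hε : 0 ≤ ε)
    (hM : IsWeaklyPrecompactWith ε M) :
    IsWeaklyPrecompactWith (2 * ε) (acoHull M) := by
  obtain ⟨R', hR'⟩ := hM.1.exists_norm_le
  have hbd : ∀ y ∈ acoHull M, ‖y‖ ≤ max R' 0 :=
    wpc_bounded M (max R' 0) (fun x hx => (hR' x hx).trans (le_max_left _ _)) (le_max_right _ _)
  refine ⟨isBounded_iff_forall_norm_le.2 ⟨_, hbd⟩, fun y hy => ?_⟩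
  let E : ℚ × ℚ → Bool → ℕ → Set (WpcK X) := fun q c n =>
    if c then {f | (q.2 : ℝ) ≤ wpcEv (y n) f} else {f | wpcEv (y n) f ≤ (q.1 : ℝ)}
  obtain ⟨e, he⟩ := exists_surjective_nat (ℚ × ℚ)
  obtain ⟨N, -, hN, hP⟩ := wpc_diag
    (fun j N => 2 * ε < ((e j).2 : ℝ) - ((e j).1 : ℝ) → ∀ f, ¬ WpcDiv (E (e j)) N f)
    Set.univ Set.infinite_univ
    (fun j M1 M2 hf h h' f hd => h h' f (hd.mono hf))
    (by
      intro j M' _ hM'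
      by_cases hj : 2 * ε < ((e j).2 : ℝ) - ((e j).1 : ℝ)
      · by_cases hbad : WpcBad (E (e j)) Set.univ M'
        · exfalso
          obtain ⟨s, hs, hcard, -, hp⟩ := wpc_tree (E (e j)) M' hM' hbad
          choose p hp using hp
          refine wpc_contra M ε hε hM y hy _ _ hj s hs hcard p ?_ ?_
          · intro k U n hn hU
            have := hp k U n hn
            simpa [E, hU] using this
          · intro k U n hn hU
            have := hp k U n hn
            simpa [E, hU] using this
        · simp only [WpcBad] at hbad
          push Not at hbad
          obtain ⟨M'', h1, h2, h3⟩ := hbad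
          exact ⟨M'', h1, h2, fun _ f => h3 f (Set.mem_univ _)⟩
      · exact ⟨M', subset_rfl, hM', fun h => absurd h hj⟩)
  obtain ⟨φ, hφ, hφN⟩ := extraction_of_frequently_atTop (Nat.frequently_atTop_iff_infinite.2 hN)
  refine ⟨φ, hφ, fun f hf => ?_⟩
  by_contra! hlt
  have hb := wpc_bddAbove (wpc_bdd (fun k => y (φ k)) _ (fun n => hbd _ (hy (φ n))) f hf)
  set ls := limsup (fun n => f (y (φ n))) atTop
  set li := liminf (fun n => f (y (φ n))) atTop
  obtain ⟨r, hr1, hr2⟩ := exists_rat_btwn (show li < li + (ls - li - 2 * ε) / 2 by linarith)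
  obtain ⟨t, ht1, ht2⟩ := exists_rat_btwn (show ls - (ls - li - 2 * ε) / 2 < ls by linarith)
  obtain ⟨j, hj⟩ := he (r, t)
  let F : WpcK X := ⟨StrongDual.toWeakDual f, by simpa using hf⟩
  have hF : ∀ x, wpcEv x F = f x := fun x => rfl
  have hgap : 2 * ε < ((e j).2 : ℝ) - ((e j).1 : ℝ) := by
    rw [hj]
    simp only
    linarith
  have f1 : ∃ᶠ n in atTop, (t : ℝ) < f (y (φ n)) :=
    frequently_lt_of_lt_limsup hb.2.isCoboundedUnder_le ht2
  have f2 : ∃ᶠ n in atTop, f (y (φ n)) < (r : ℝ) :=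
    frequently_lt_of_liminf_lt hb.1.isCoboundedUnder_ge hr1
  refine hP j hgap F fun c => ?_
  cases c with
  | true =>
    refine ((Nat.frequently_atTop_iff_infinite.1 f1).image hφ.injective.injOn).mono ?_
    rintro _ ⟨n, hn, rfl⟩
    refine ⟨hφN n, ?_⟩
    simp only [E, if_true, hj, Set.mem_ofPred_eq, hF]
    exact le_of_lt hn
  | false =>
    refine ((Nat.frequently_atTop_iff_infinite.1 f2).image hφ.injective.injOn).mono ?_
    rintro _ ⟨n, hn, rfl⟩
    refine ⟨hφN n, ?_⟩
    simp only [E, hj, Bool.false_eq_true, if_false, Set.mem_ofPred_eq, hF]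
    exact le_of_lt hn
end

section
/- Let X be a real Banach space, M ⊆ X and ε ≥ 0. If M is ε-precompact, then the absolutely convex hull aco(M) of M (the convex balanced hull, i.e., the set of all sums ∑ a_i x_i with x_i ∈ M and ∑ |a_i| ≤ 1) is ε-precompact. -/
open Filter Topology

/-- `ca((x_n)) ≤ ε`, where `ca((x_n)) := inf_m sup_{n,n' ≥ m} ‖x_n − x_{n'}‖`. -/
def CaLE {E : Type*} [NormedAddCommGroup E] (x : ℕ → E) (ε : ℝ) : Prop :=
  ∀ η : ℝ, 0 < η → ∃ m : ℕ, ∀ n ≥ m, ∀ n' ≥ m, ‖x n - x n'‖ ≤ ε + η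

/-- A set `M` is `ε`-precompact if it is bounded and every sequence in `M`
admits a subsequence `(x_{n_k})` with `ca((x_{n_k})) ≤ ε`. -/
def IsPrecompactWith {E : Type*} [NormedAddCommGroup E] (ε : ℝ) (M : Set E) : Prop :=
  Bornology.IsBounded M ∧
    ∀ x : ℕ → E, (∀ n, x n ∈ M) →
      ∃ φ : ℕ → ℕ, StrictMono φ ∧ CaLE (fun k => x (φ k)) ε

open MeasureTheory Set

lemma exists_coding {X : Type*} [NormedAddCommGroup X] (N : Set X)
    (hN : Bornology.IsBounded N) (z : ℕ → X) :
    ∃ T : X → ℝ, (∀ x, T x ∈ Icc (0:ℝ) 1) ∧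
      ∀ u : ℕ → X, (∀ n, u n ∈ N) → ∀ l, Tendsto (fun n => T (u n)) atTop (𝓝 l) →
        ∀ j, ∃ h, Tendsto (fun n => ‖u n - z j‖) atTop (𝓝 h) := by
  obtain ⟨C, hC0, hC⟩ := hN.exists_pos_norm_le
  let τ : X → ℕ → Icc (0:ℝ) 1 := fun x j =>
    projIcc 0 1 zero_le_one (‖x - z j‖ / (C + ‖z j‖))
  let _ : MetricSpace (ℕ → Icc (0:ℝ) 1) := TopologicalSpace.metrizableSpaceMetric _
  obtain ⟨f, hf, hsurj⟩ := exists_nat_bool_continuous_surjective_of_compact (ℕ → Icc (0:ℝ) 1)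
  choose p hp using fun x => hsurj (τ x)
  let e := cantorSetHomeomorphNatToBool
  refine ⟨fun x => (e.symm (p x) : ℝ), fun x => cantorSet_subset_unitInterval (e.symm (p x)).2, ?_⟩
  intro u hu l hl j
  have hlm : l ∈ cantorSet :=
    isClosed_cantorSet.mem_of_tendsto hl (Eventually.of_forall fun n => (e.symm (p (u n))).2)
  have h1 : Tendsto (fun n => e.symm (p (u n))) atTop (𝓝 ⟨l, hlm⟩) :=
    tendsto_subtype_rng.2 hl
  have h2 : Tendsto (fun n => f (e (e.symm (p (u n))))) atTop (𝓝 (f (e ⟨l, hlm⟩))) :=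
    ((hf.comp e.continuous).tendsto _).comp h1
  simp only [Homeomorph.apply_symm_apply, hp] at h2
  have h3 := (tendsto_subtype_rng.1 ((tendsto_pi_nhds.1 h2) j))
  have hD : 0 < C + ‖z j‖ := by positivity
  refine ⟨_, (h3.const_mul (C + ‖z j‖)).congr fun n => ?_⟩
  have hmem : ‖u n - z j‖ / (C + ‖z j‖) ∈ Icc (0:ℝ) 1 := by
    refine ⟨by positivity, (div_le_one hD).2 ?_⟩
    exact (norm_sub_le _ _).trans (by linarith [hC _ (hu n)])
  simp only [τ, projIcc_of_mem _ hmem]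
  field_simp

lemma helly_mono (g : ℕ → ℝ → ℝ) (hg : ∀ n, MonotoneOn (g n) (Ico 0 1))
    (hb : ∀ n, ∀ t, g n t ∈ Icc (0:ℝ) 1) :
    ∃ φ : ℕ → ℕ, StrictMono φ ∧ ∃ S : Set ℝ, S.Countable ∧
      ∀ t ∈ Ico (0:ℝ) 1, t ∉ S → ∃ l, Tendsto (fun n => g (φ n) t) atTop (𝓝 l) := by
  let A : ℕ → ℚ → Set ℝ := fun n c => {t | t ∈ Ico (0:ℝ) 1 ∧ g n t ≤ c}
  have hA : ∀ n c, BddAbove (A n c) := fun n c => ⟨1, fun t ht => ht.1.2.le⟩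
  have hF : ∀ n c, sSup (A n c) ∈ Icc (0:ℝ) 1 := fun n c =>
    ⟨Real.sSup_nonneg fun t ht => ht.1.1, Real.sSup_le (fun t ht => ht.1.2.le) zero_le_one⟩
  let F : ℕ → ℚ → Icc (0:ℝ) 1 := fun n c => ⟨sSup (A n c), hF n c⟩
  obtain ⟨L, φ, hφ, hL⟩ := CompactSpace.tendsto_subseq F
  refine ⟨φ, hφ, range fun c => (L c : ℝ), countable_range _, ?_⟩
  intro t ht htS
  refine tendsto_of_no_upcrossings (s := range ((↑) : ℚ → ℝ)) Rat.denseRange_cast ?_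
    (isBoundedUnder_of ⟨1, fun n => (hb _ t).2⟩) (isBoundedUnder_of ⟨0, fun n => (hb _ t).1⟩)
  rintro _ ⟨a, rfl⟩ _ ⟨b, rfl⟩ hab ⟨h1, h2⟩
  have hLa : Tendsto (fun n => sSup (A (φ n) a)) atTop (𝓝 (L a : ℝ)) :=
    tendsto_subtype_rng.1 ((tendsto_pi_nhds.1 hL) a)
  rcases lt_trichotomy t (L a) with h | h | h
  · refine h2 ?_
    filter_upwards [hLa.eventually (lt_mem_nhds h)] with n hn hbn
    have hne : (A (φ n) a).Nonempty := by
      by_contra hne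
      rw [not_nonempty_iff_eq_empty] at hne
      rw [hne, Real.sSup_empty] at hn
      exact absurd ht.1 (not_le.2 hn)
    obtain ⟨s, hs, hts⟩ := exists_lt_of_lt_csSup hne hn
    have := hg (φ n) ht hs.1 hts.le
    have := hs.2
    linarith
  · exact htS ⟨a, h.symm⟩
  · refine h1 ?_
    filter_upwards [hLa.eventually (gt_mem_nhds h)] with n hn han
    exact absurd (le_csSup (hA (φ n) a) ⟨ht, han.le⟩) (not_le.2 hn)

lemma pointwise_lim {X : Type*} [NormedAddCommGroup X] {N : Set X} {ε : ℝ}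
    (hN : IsPrecompactWith ε N) (u : ℕ → X) (hu : ∀ n, u n ∈ N) (h : ℕ → ℝ)
    (hh : ∀ n, Tendsto (fun m => ‖u n - u m‖) atTop (𝓝 (h n))) :
    Tendsto (fun n => max (h n) ε) atTop (𝓝 ε) := by
  refine tendsto_of_subseq_tendsto fun ns hns => ?_
  obtain ⟨ψ, hψ, hca⟩ := hN.2 (fun k => u (ns k)) (fun k => hu _)
  refine ⟨ψ, ?_⟩
  rw [Metric.tendsto_atTop]
  intro η hη
  obtain ⟨m, hm⟩ := hca (η / 2) (by positivity)
  refine ⟨m, fun k hk => ?_⟩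
  have h1 : h (ns (ψ k)) ≤ ε + η / 2 := by
    refine le_of_tendsto ((hh (ns (ψ k))).comp (hns.comp hψ.tendsto_atTop)) ?_
    filter_upwards [eventually_ge_atTop m] with k' hk'
    exact hm k hk k' hk'
  rw [Real.dist_eq, abs_of_nonneg (by simp)]
  have : max (h (ns (ψ k))) ε ≤ ε + η / 2 := max_le h1 (by linarith)
  linarith

lemma exists_step {X : Type*} [NormedAddCommGroup X] [NormedSpace ℝ X] [CompleteSpace X]
    (m : ℕ) (a : ℕ → ℝ) (x : ℕ → X) (ha : ∀ i, 0 ≤ a i)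
    (hs : ∑ i ∈ Finset.range m, a i = 1) (T : X → ℝ) :
    ∃ f : ℝ → X, StronglyMeasurable f ∧ (∀ t ∈ Ico (0:ℝ) 1, ∃ i < m, f t = x i) ∧
      MonotoneOn (fun t => T (f t)) (Ico 0 1) ∧
      ∫ t in Ico (0:ℝ) 1, f t = ∑ i ∈ Finset.range m, a i • x i := by
  let σ := Tuple.sort (fun i : Fin m => T (x i))
  have hσ : Monotone ((fun i : Fin m => T (x i)) ∘ σ) := Tuple.monotone_sort _
  let b : ℕ → ℝ := fun i => if h : i < m then a (σ ⟨i, h⟩) else 0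
  let w : ℕ → X := fun i => if h : i < m then x (σ ⟨i, h⟩) else 0
  have hb0 : ∀ i, 0 ≤ b i := by
    intro i
    by_cases h : i < m <;> simp [b, h, ha]
  have hbs : ∑ i ∈ Finset.range m, b i = 1 := by
    rw [Finset.sum_range, ← hs, Finset.sum_range, ← Equiv.sum_comp σ (fun i : Fin m => a i)]
    refine Finset.sum_congr rfl fun i _ => ?_
    simp [b]
  have hws : ∑ i ∈ Finset.range m, b i • w i = ∑ i ∈ Finset.range m, a i • x i := by
    rw [Finset.sum_range, Finset.sum_range, ← Equiv.sum_comp σ (fun i : Fin m => a i • x i)]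
    refine Finset.sum_congr rfl fun i _ => ?_
    simp [b, w]
  have hwT : ∀ i j, i ≤ j → j < m → T (w i) ≤ T (w j) := by
    intro i j hij hj
    have hi : i < m := lt_of_le_of_lt hij hj
    simp only [w, hi, hj, dif_pos]
    exact hσ (show (⟨i, hi⟩ : Fin m) ≤ ⟨j, hj⟩ from hij)
  let S : ℕ → ℝ := fun k => ∑ i ∈ Finset.range k, b i
  have hS : Monotone S := monotone_nat_of_le_succ fun k => by
    simp only [S, Finset.sum_range_succ]; linarith [hb0 k]
  have hS0 : S 0 = 0 := by simp [S]
  have hSm : S m = 1 := hbs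
  let f : ℝ → X := fun t => ∑ i ∈ Finset.range m, (Ico (S i) (S (i+1))).indicator (fun _ => w i) t
  have huniq : ∀ i j t, t ∈ Ico (S i) (S (i+1)) → t ∈ Ico (S j) (S (j+1)) → i ≤ j := by
    intro i j t hi hj
    by_contra! hlt
    have := hS (show j + 1 ≤ i from hlt)
    linarith [hi.1, hj.2]
  have hval : ∀ t i, i < m → t ∈ Ico (S i) (S (i+1)) → f t = w i := by
    intro t i hi ht
    simp only [f]
    rw [Finset.sum_eq_single i]
    · simp [indicator_of_mem ht]
    · intro j _ hji
      refine indicator_of_notMem (fun hj => hji ?_) _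
      exact le_antisymm (huniq _ _ _ hj ht) (huniq _ _ _ ht hj)
    · intro h; exact absurd (Finset.mem_range.2 hi) h
  have hex : ∀ t ∈ Ico (0:ℝ) 1, ∃ i < m, t ∈ Ico (S i) (S (i+1)) := by
    classical
    intro t ht
    have hk : ∃ k, t < S k := ⟨m, by rw [hSm]; exact ht.2⟩
    obtain ⟨k, hkk⟩ : ∃ k, Nat.find hk = k := ⟨_, rfl⟩
    have h1 := Nat.find_spec hk
    have h2 : Nat.find hk ≤ m := Nat.find_min' hk (by rw [hSm]; exact ht.2)
    rw [hkk] at h1 h2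
    cases k with
    | zero => rw [hS0] at h1; exact absurd ht.1 (not_le.2 h1)
    | succ k =>
      refine ⟨k, h2, ?_, h1⟩
      exact not_lt.1 (Nat.find_min hk (by omega))
  refine ⟨f, ?_, ?_, ?_, ?_⟩
  · refine Finset.stronglyMeasurable_fun_sum _ fun i _ => ?_
    exact stronglyMeasurable_const.indicator measurableSet_Ico
  · intro t ht
    obtain ⟨i, hi, hti⟩ := hex t ht
    refine ⟨σ ⟨i, hi⟩, (σ ⟨i, hi⟩).2, ?_⟩
    rw [hval t i hi hti]
    simp [w, hi]
  · intro t ht t' ht' htt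
    obtain ⟨i, hi, hti⟩ := hex t ht
    obtain ⟨j, hj, htj⟩ := hex t' ht'
    simp only [hval t i hi hti, hval t' j hj htj]
    refine hwT i j ?_ hj
    by_contra! hlt
    have := hS (show j + 1 ≤ i from hlt)
    linarith [hti.1, htj.2]
  · rw [← hws]
    simp only [f]
    rw [integral_finsetSum]
    · refine Finset.sum_congr rfl fun i hi => ?_
      have hi' := Finset.mem_range.1 hi
      have hsub : Ico (S i) (S (i+1)) ⊆ Ico 0 1 := by
        refine Ico_subset_Ico ?_ ?_
        · rw [← hS0]; exact hS (Nat.zero_le _)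
        · rw [← hSm]; exact hS hi'
      rw [integral_indicator_const _ measurableSet_Ico]
      congr 1
      rw [measureReal_restrict_apply measurableSet_Ico, inter_eq_left.2 hsub,
        Real.volume_real_Ico_of_le (hS (Nat.le_succ i))]
      simp [S, Finset.sum_range_succ]
    · intro i _
      exact (integrable_const (w i)).indicator measurableSet_Ico

lemma precompact_union {X : Type*} [NormedAddCommGroup X] {A B : Set X} {ε : ℝ}
    (hA : IsPrecompactWith ε A) (hB : IsPrecompactWith ε B) : IsPrecompactWith ε (A ∪ B) := by
  refine ⟨hA.1.union hB.1, fun x hx => ?_⟩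
  by_cases h : ∃ᶠ n in atTop, x n ∈ A
  · obtain ⟨φ, hφ, h1⟩ := extraction_of_frequently_atTop h
    obtain ⟨ψ, hψ, h2⟩ := hA.2 (fun n => x (φ n)) h1
    exact ⟨φ ∘ ψ, hφ.comp hψ, h2⟩
  · rw [not_frequently] at h
    obtain ⟨φ, hφ, h1⟩ := extraction_of_eventually_atTop h
    obtain ⟨ψ, hψ, h2⟩ := hB.2 (fun n => x (φ n)) (fun n => (hx _).resolve_left (h1 n))
    exact ⟨φ ∘ ψ, hφ.comp hψ, h2⟩

lemma precompact_neg {X : Type*} [NormedAddCommGroup X] {A : Set X} {ε : ℝ}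
    (hA : IsPrecompactWith ε A) : IsPrecompactWith ε {x | -x ∈ A} := by
  refine ⟨?_, fun x hx => ?_⟩
  · obtain ⟨C, hC⟩ := hA.1.exists_norm_le
    exact isBounded_iff_forall_norm_le.2 ⟨C, fun x hx => by simpa using hC _ hx⟩
  · obtain ⟨ψ, hψ, h2⟩ := hA.2 (fun n => - x n) hx
    refine ⟨ψ, hψ, fun η hη => ?_⟩
    obtain ⟨m, hm⟩ := h2 η hη
    refine ⟨m, fun n hn n' hn' => ?_⟩
    have := hm n hn n' hn'
    rwa [← norm_neg, show -(x (ψ n) - x (ψ n')) = - x (ψ n) - - x (ψ n') by abel]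

lemma precompact_zero {X : Type*} [NormedAddCommGroup X] {ε : ℝ} (hε : 0 ≤ ε) :
    IsPrecompactWith ε ({0} : Set X) := by
  refine ⟨Bornology.isBounded_singleton, fun x hx => ⟨id, strictMono_id, fun η hη => ?_⟩⟩
  refine ⟨0, fun n _ n' _ => ?_⟩
  have h1 : x n = 0 := hx n
  have h2 : x n' = 0 := hx n'
  simp only [id, h1, h2, sub_zero, norm_zero]
  positivity

/-- a signed combination is a convex combination of the symmetrised set -/
lemma acoHull_repr {X : Type*} [NormedAddCommGroup X] [NormedSpace ℝ X] (M : Set X)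
    (y : X) (hy : y ∈ acoHull M) :
    ∃ (m : ℕ) (a : ℕ → ℝ) (x : ℕ → X), (∀ i, 0 ≤ a i) ∧
      (∀ i < m, x i ∈ (M ∪ {x | -x ∈ M}) ∪ {0}) ∧ ∑ i ∈ Finset.range m, a i = 1 ∧
      y = ∑ i ∈ Finset.range m, a i • x i := by
  obtain ⟨m, a, x, hx, ha, rfl⟩ := hy
  refine ⟨m + 1, fun i => if i < m then |a i| else 1 - ∑ i ∈ Finset.range m, |a i|,
    fun i => if i < m then (if 0 ≤ a i then x i else - x i) else 0, ?_, ?_, ?_, ?_⟩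
  · intro i
    dsimp only
    split_ifs
    · positivity
    · linarith
  · intro i _
    dsimp only
    split_ifs with h1 h2
    · exact Or.inl (Or.inl (hx i h1))
    · exact Or.inl (Or.inr (by simpa using hx i h1))
    · exact Or.inr rfl
  · rw [Finset.sum_range_succ, Finset.sum_congr rfl (g := fun i => |a i|)]
    · simp
    · intro i hi; simp [Finset.mem_range.1 hi]
  · rw [Finset.sum_range_succ]
    simp only [lt_irrefl, if_false, smul_zero, add_zero]
    refine Finset.sum_congr rfl fun i hi => ?_
    simp only [Finset.mem_range.1 hi, if_true]
    split_ifs with h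
    · rw [abs_of_nonneg h]
    · rw [abs_of_neg (not_le.1 h)]; simp

lemma extract_ca {X : Type*} [NormedAddCommGroup X] (y : ℕ → X) (ε : ℝ) (hε : 0 ≤ ε)
    (h : ℕ → ℝ) (hh : Tendsto h atTop (𝓝 ε))
    (hy : ∀ n, ∀ η > 0, ∀ᶠ m in atTop, ‖y n - y m‖ ≤ h n + η) :
    ∃ φ : ℕ → ℕ, StrictMono φ ∧ CaLE (fun k => y (φ k)) ε := by
  have hy' : ∀ n : ℕ, ∃ g, ∀ m ≥ g, ‖y n - y m‖ ≤ h n + 1 / ((n:ℝ) + 1) := fun n =>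
    eventually_atTop.1 (hy n _ (by positivity))
  choose g hg using hy'
  obtain ⟨φ, -, hφ⟩ := exists_seq_of_forall_finset_exists (fun _ : ℕ => True)
    (fun a b => a < b ∧ g a ≤ b) (fun s _ => ⟨∑ i ∈ s, (i + 1 + g i), trivial, fun i hi => by
      have := Finset.single_le_sum (f := fun i => i + 1 + g i) (fun _ _ => Nat.zero_le _) hi
      omega⟩)
  have hmono : StrictMono φ := fun a b hab => (hφ a b hab).1
  refine ⟨φ, hmono, fun η hη => ?_⟩
  have h1 : Tendsto (fun n : ℕ => h n + 1 / ((n:ℝ) + 1)) atTop (𝓝 (ε + 0)) :=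
    hh.add tendsto_one_div_add_atTop_nhds_zero_nat
  have h2 := (h1.comp hmono.tendsto_atTop).eventually (gt_mem_nhds (show ε + 0 < ε + η by linarith))
  obtain ⟨m, hm⟩ := eventually_atTop.1 h2
  have key : ∀ n ≥ m, ∀ n', n < n' → ‖y (φ n) - y (φ n')‖ ≤ ε + η := fun n hn n' hnn =>
    (hg _ _ (hφ n n' hnn).2).trans (hm n hn).le
  refine ⟨m, fun n hn n' hn' => ?_⟩
  rcases lt_trichotomy n n' with h | h | h
  · exact key n hn n' h
  · subst h; simp; positivity
  · dsimp only
    rw [norm_sub_rev]; exact key n' hn' n h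

lemma main_conv {X : Type*} [NormedAddCommGroup X] [NormedSpace ℝ X] [CompleteSpace X]
    (N : Set X) (ε : ℝ) (hε : 0 ≤ ε) (hN : IsPrecompactWith ε N) (y : ℕ → X)
    (hy : ∀ n, ∃ (m : ℕ) (a : ℕ → ℝ) (x : ℕ → X), (∀ i, 0 ≤ a i) ∧
      (∀ i < m, x i ∈ N) ∧ ∑ i ∈ Finset.range m, a i = 1 ∧
      y n = ∑ i ∈ Finset.range m, a i • x i) :
    ∃ φ : ℕ → ℕ, StrictMono φ ∧ CaLE (fun k => y (φ k)) ε := by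
  choose m a x ha hx hs hyx using hy
  obtain ⟨T, hT01, hT⟩ := exists_coding N hN.1 (fun j => x j.unpair.1 j.unpair.2)
  choose f hfm hfx hfT hfi using fun n => exists_step (m n) (a n) (x n) (ha n) (hs n) T
  obtain ⟨φ, hφ, S, hS, hconv⟩ := helly_mono (fun n t => T (f n t)) hfT (fun n t => hT01 _)
  have hfN : ∀ n, ∀ t ∈ Ico (0:ℝ) 1, f n t ∈ N := fun n t ht => by
    obtain ⟨i, hi, h⟩ := hfx n t ht
    rw [h]; exact hx n i hi
  obtain ⟨C, hC0, hC⟩ := hN.1.exists_pos_norm_le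
  let μ : Measure ℝ := volume.restrict (Ico (0:ℝ) 1)
  have hae : ∀ᵐ t ∂μ, t ∈ Ico (0:ℝ) 1 := ae_restrict_mem measurableSet_Ico
  have haeS : ∀ᵐ t ∂μ, t ∉ S := ae_restrict_of_ae (hS.ae_notMem volume)
  have hprob : μ.real univ = 1 := by simp [μ]
  -- pointwise limits
  have hlim : ∀ t, ∀ n, ∃ h, t ∈ Ico (0:ℝ) 1 → t ∉ S →
      Tendsto (fun k => ‖f (φ n) t - f (φ k) t‖) atTop (𝓝 h) := by
    intro t n
    by_cases ht : t ∈ Ico (0:ℝ) 1 ∧ t ∉ S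
    · obtain ⟨l, hl⟩ := hconv t ht.1 ht.2
      obtain ⟨i, hi, hfi'⟩ := hfx (φ n) t ht.1
      obtain ⟨h, hh⟩ := hT (fun k => f (φ k) t) (fun k => hfN _ t ht.1) l hl (Nat.pair (φ n) i)
      refine ⟨h, fun _ _ => hh.congr fun k => ?_⟩
      simp only [Nat.unpair_pair]
      rw [← hfi', norm_sub_rev]
    · exact ⟨0, fun h1 h2 => absurd ⟨h1, h2⟩ ht⟩
  choose h hh using hlim
  have hbd : ∀ n k, ∀ t ∈ Ico (0:ℝ) 1, ‖f n t - f k t‖ ≤ 2 * C := fun n k t ht =>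
    (norm_sub_le _ _).trans (by linarith [hC _ (hfN n t ht), hC _ (hfN k t ht)])
  have hmeas : ∀ n k, AEStronglyMeasurable (fun t => ‖f n t - f k t‖) μ := fun n k =>
    ((hfm n).sub (hfm k)).norm.aestronglyMeasurable
  have hint1 : ∀ n, Tendsto (fun k => ∫ t, ‖f (φ n) t - f (φ k) t‖ ∂μ) atTop
      (𝓝 (∫ t, h t n ∂μ)) := by
    intro n
    refine tendsto_integral_of_dominated_convergence (fun _ => 2 * C) (fun k => hmeas _ _)
      (integrable_const _) (fun k => ?_) ?_
    · filter_upwards [hae] with t ht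
      simpa using hbd _ _ t ht
    · filter_upwards [hae, haeS] with t ht htS
      exact hh t n ht htS
  have hhm : ∀ n, AEStronglyMeasurable (fun t => h t n) μ := fun n => by
    refine aestronglyMeasurable_of_tendsto_ae atTop (fun k => hmeas (φ n) (φ k)) ?_
    filter_upwards [hae, haeS] with t ht htS
    exact hh t n ht htS
  have hhb : ∀ n, ∀ᵐ t ∂μ, h t n ∈ Icc 0 (2 * C) := fun n => by
    filter_upwards [hae, haeS] with t ht htS
    exact ⟨ge_of_tendsto' (hh t n ht htS) fun k => norm_nonneg _,
      le_of_tendsto' (hh t n ht htS) fun k => hbd _ _ t ht⟩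
  have hmaxm : ∀ n, AEStronglyMeasurable (fun t => max (h t n) ε) μ := fun n =>
    (hhm n).sup aestronglyMeasurable_const
  have hmaxb : ∀ n, ∀ᵐ t ∂μ, ‖max (h t n) ε‖ ≤ 2 * C + ε := fun n => by
    filter_upwards [hhb n] with t ht
    rw [Real.norm_of_nonneg (le_max_of_le_right hε)]
    exact max_le (by linarith [ht.2]) (by linarith)
  have hint2 : Tendsto (fun n => ∫ t, max (h t n) ε ∂μ) atTop (𝓝 ε) := by
    have : Tendsto (fun n => ∫ t, max (h t n) ε ∂μ) atTop (𝓝 (∫ t, ε ∂μ)) := by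
      refine tendsto_integral_of_dominated_convergence (fun _ => 2 * C + ε) hmaxm
        (integrable_const _) hmaxb ?_
      filter_upwards [hae, haeS] with t ht htS
      exact pointwise_lim hN (fun n => f (φ n) t) (fun n => hfN _ t ht) (h t)
        (fun n => hh t n ht htS)
    simpa [integral_const, hprob] using this
  have hfint : ∀ n, Integrable (f n) μ := fun n => by
    refine Integrable.mono' (integrable_const C) (hfm n).aestronglyMeasurable ?_
    filter_upwards [hae] with t ht
    exact hC _ (hfN n t ht)
  have hyf : ∀ n k, ‖y n - y k‖ ≤ ∫ t, ‖f n t - f k t‖ ∂μ := by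
    intro n k
    rw [hyx n, hyx k, ← hfi n, ← hfi k, ← integral_sub (hfint n) (hfint k)]
    exact norm_integral_le_integral_norm _
  obtain ⟨ψ, hψ, hca⟩ := extract_ca (fun n => y (φ n)) ε hε _ hint2 (by
    intro n η hη
    have hle : ∫ t, h t n ∂μ ≤ ∫ t, max (h t n) ε ∂μ := by
      refine integral_mono_ae ?_ ?_ (Eventually.of_forall fun t => le_max_left _ _)
      · refine Integrable.mono' (integrable_const (2 * C)) (hhm n) ?_
        filter_upwards [hhb n] with t ht
        rw [Real.norm_of_nonneg ht.1]; exact ht.2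
      · exact Integrable.mono' (integrable_const (2 * C + ε)) (hmaxm n) (hmaxb n)
    filter_upwards [(hint1 n).eventually (gt_mem_nhds (lt_add_of_pos_right _ hη))] with k hk
    have := hyf (φ n) (φ k)
    linarith)
  exact ⟨φ ∘ ψ, hφ.comp hψ, hca⟩

theorem acoHull_precompact
    {X : Type*} [NormedAddCommGroup X] [NormedSpace ℝ X] [CompleteSpace X]
    (M : Set X) (ε : ℝ) (hε : 0 ≤ ε)
    (hM : IsPrecompactWith ε M) :
    IsPrecompactWith ε (acoHull M) := by
  refine ⟨?_, fun y hy => ?_⟩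
  · obtain ⟨C, hC0, hC⟩ := hM.1.exists_pos_norm_le
    refine isBounded_iff_forall_norm_le.2 ⟨C, ?_⟩
    rintro _ ⟨m, a, x, hx, ha, rfl⟩
    calc ‖∑ i ∈ Finset.range m, a i • x i‖ ≤ ∑ i ∈ Finset.range m, |a i| * C := by
          refine norm_sum_le_of_le _ fun i hi => ?_
          rw [norm_smul, Real.norm_eq_abs]
          exact mul_le_mul_of_nonneg_left (hC _ (hx i (Finset.mem_range.1 hi))) (abs_nonneg _)
      _ = (∑ i ∈ Finset.range m, |a i|) * C := by rw [Finset.sum_mul]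
      _ ≤ 1 * C := by gcongr
      _ = C := one_mul C
  · exact main_conv _ ε hε
      (precompact_union (precompact_union hM (precompact_neg hM)) (precompact_zero hε)) y
      (fun n => acoHull_repr M (y n) (hy n))
end

section
/- Let (Ω,Σ,μ) be a probability space, X a real Banach space, and ε ≥ 0. Let F : Ω → P(X) be a multi-function such that F(ω) is ε-weakly precompact for μ-a.e. ω ∈ Ω, and let S₁(F) denote the set of all (equivalence classes of) Bochner μ-integrable functions f : Ω → X with f(ω) ∈ F(ω) for μ-a.e. ω. If (f_n) is a uniformly integrable sequence in S₁(F), then (f_n) is not an ℓ₁-sequence in L¹(μ,X) with constant C for any C > ε. -/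
open Filter Topology MeasureTheory

/-- `(x_n)` is an `ℓ₁`-sequence with constant `c`. -/
def IsL1SeqWith {E : Type*} [NormedAddCommGroup E] [NormedSpace ℝ E]
    (c : ℝ) (x : ℕ → E) : Prop :=
  Bornology.IsBounded (Set.range x) ∧
    ∀ (m : ℕ) (a : ℕ → ℝ),
      c * ∑ n ∈ Finset.range m, |a n| ≤ ‖∑ n ∈ Finset.range m, a n • x n‖

/-- A set `W ⊆ L¹(μ,X)` is uniformly integrable: it is bounded and for every `η > 0`
there is `δ > 0` such that `∫_A ‖f‖ dμ ≤ η` for all `f ∈ W` and all `A` with `μ(A) ≤ δ`. -/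
def UnifIntegrableSet {Ω X : Type*} [MeasurableSpace Ω] [NormedAddCommGroup X]
    (μ : Measure Ω) (W : Set (Lp X 1 μ)) : Prop :=
  Bornology.IsBounded W ∧
    ∀ η : ℝ, 0 < η → ∃ δ : ℝ, 0 < δ ∧
      ∀ f ∈ W, ∀ A : Set Ω, MeasurableSet A → μ A ≤ ENNReal.ofReal δ →
        ∫ ω in A, ‖f ω‖ ∂μ ≤ η


theorem helly_ext {E : Type*} [AddCommGroup E] [Module ℝ E] (N : E → ℝ)
    (N_hom : ∀ c : ℝ, 0 < c → ∀ x, N (c • x) = c * N x)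
    (N_add : ∀ x y, N (x + y) ≤ N x + N y)
    (x : ℕ → E) (c : ℕ → ℝ)
    (h : ∀ (m : ℕ) (a : ℕ → ℝ), ∑ n ∈ Finset.range m, a n * c n
      ≤ N (∑ n ∈ Finset.range m, a n • x n)) :
    ∃ g : E →ₗ[ℝ] ℝ, (∀ y, g y ≤ N y) ∧ ∀ n, g (x n) = c n := by
  let T := Finsupp.linearCombination ℝ x
  let L := Finsupp.linearCombination ℝ c
  have hTL : ∀ a, L a ≤ N (T a) := by
    intro a
    obtain ⟨m, hm⟩ := Finset.exists_nat_subset_range a.support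
    have := h m a
    have e1 : L a = ∑ n ∈ Finset.range m, a n * c n := by
      simp only [L, Finsupp.linearCombination_apply]
      exact Finsupp.sum_of_support_subset _ hm _ (by simp)
    have e2 : T a = ∑ n ∈ Finset.range m, a n • x n := by
      simp only [T, Finsupp.linearCombination_apply]
      exact Finsupp.sum_of_support_subset _ hm _ (by simp)
    rw [e1, e2]; exact this
  have N0 : N 0 = 0 := by
    have := N_hom 2 (by norm_num) 0
    rw [smul_zero] at this; linarith
  have hker : ∀ a, T a = 0 → L a = 0 := by
    intro a ha
    have h1 := hTL a
    have h2 := hTL (-a)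
    rw [map_neg, map_neg, ha] at h2
    rw [ha] at h1
    simp only [neg_zero, N0] at h1 h2
    linarith
  obtain ⟨R, hR⟩ := T.rangeRestrict.exists_rightInverse_of_surjective T.range_rangeRestrict
  have hR' : ∀ y : LinearMap.range T, T (R y) = y := by
    intro y
    have := congrArg (fun f => ((f y : LinearMap.range T) : E)) hR
    simpa using this
  have hf : ∀ a, L (R ⟨T a, a, rfl⟩) = L a := by
    intro a
    have := hker (R ⟨T a, a, rfl⟩ - a) (by rw [map_sub, hR']; simp)
    rw [map_sub] at this; linarith
  obtain ⟨g, hg1, hg2⟩ := exists_extension_of_le_sublinear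
    (⟨LinearMap.range T, L ∘ₗ R⟩ : E →ₗ.[ℝ] ℝ) N N_hom N_add (by
      rintro ⟨_, a, rfl⟩
      change L (R ⟨T a, a, rfl⟩) ≤ _
      rw [hf]; exact hTL a)
  refine ⟨g, hg2, fun n => ?_⟩
  have h1 := hg1 ⟨T (Finsupp.single n 1), _, rfl⟩
  change g (T (Finsupp.single n 1)) = L (R ⟨T (Finsupp.single n 1), _, rfl⟩) at h1
  rw [hf] at h1
  simpa [T, L] using h1

theorem exists_functional {Θ X : Type*} [MeasurableSpace Θ] [NormedAddCommGroup X]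
    [NormedSpace ℝ X] (P : Measure Θ) (Z : ℕ → Θ → X) (hZ : ∀ n, Integrable (Z n) P)
    (C : ℝ) (hC : 0 ≤ C)
    (h : ∀ (m : ℕ) (a : ℕ → ℝ), C * ∑ n ∈ Finset.range m, |a n|
      ≤ ∫ t, ‖∑ n ∈ Finset.range m, a n • Z n t‖ ∂P) :
    ∃ Ψ : (Θ → X) → ℝ,
      (∀ G H, Integrable G P → Integrable H P → Ψ (G + H) = Ψ G + Ψ H) ∧
      (∀ (c : ℝ) G, Integrable G P → Ψ (c • G) = c * Ψ G) ∧
      (∀ G, Integrable G P → Ψ G ≤ ∫ t, ‖G t‖ ∂P) ∧ ∀ n, Ψ (Z n) = C := by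
  let V : Submodule ℝ (Θ → X) :=
    { carrier := {G | Integrable G P}
      add_mem' := fun ha hb => ha.add hb
      zero_mem' := integrable_zero _ _ _
      smul_mem' := fun c G hG => hG.smul c }
  obtain ⟨g, hg1, hg2⟩ := helly_ext (E := V) (fun G => ∫ t, ‖G.1 t‖ ∂P)
    (by
      intro c hc G
      simp only [Submodule.coe_smul, Pi.smul_apply, norm_smul, Real.norm_eq_abs, abs_of_pos hc]
      exact integral_const_mul _ _)
    (by
      intro G H
      rw [← integral_add G.2.norm H.2.norm]
      exact integral_mono (G.2.add H.2).norm (G.2.norm.add H.2.norm) fun t => norm_add_le _ _)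
    (fun n => (⟨Z n, hZ n⟩ : V)) (fun _ => C) (by
      intro m a
      have h1 := h m a
      have e : ∀ t, ((∑ n ∈ Finset.range m, a n • (⟨Z n, hZ n⟩ : V) : V) : Θ → X) t
          = ∑ n ∈ Finset.range m, a n • Z n t := by
        intro t
        simp [Finset.sum_apply]
      simp only [e]
      refine le_trans ?_ h1
      rw [← Finset.sum_mul, mul_comm]
      exact mul_le_mul_of_nonneg_left (Finset.sum_le_sum fun i _ => le_abs_self _) hC)
  classical
  refine ⟨fun G => if hG : Integrable G P then g ⟨G, hG⟩ else 0, ?_, ?_, ?_, ?_⟩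
  · intro G H hG hH
    simp only [hG, hH, hG.add hH, dif_pos]
    rw [← map_add]; rfl
  · intro c G hG
    simp only [hG, hG.smul c, dif_pos]
    rw [← smul_eq_mul, ← map_smul]; rfl
  · intro G hG
    simp only [hG, dif_pos]
    exact hg1 ⟨G, hG⟩
  · intro n
    simp only [hZ n, dif_pos]
    exact hg2 n

theorem exists_density {Θ X : Type*} [MeasurableSpace Θ] [NormedAddCommGroup X]
    [NormedSpace ℝ X] (P : Measure Θ) [IsFiniteMeasure P] (Ψ : (Θ → X) → ℝ)
    (hadd : ∀ G H, Integrable G P → Integrable H P → Ψ (G + H) = Ψ G + Ψ H)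
    (hsmul : ∀ (c : ℝ) G, Integrable G P → Ψ (c • G) = c * Ψ G)
    (hle : ∀ G, Integrable G P → Ψ G ≤ ∫ t, ‖G t‖ ∂P)
    (G : Θ → X) (hG : Integrable G P) :
    ∃ h : Θ → ℝ, Measurable h ∧ Integrable h P ∧
      ∀ A, MeasurableSet A → ∫ t in A, h t ∂P = Ψ (A.indicator G) := by
  classical
  have habs : ∀ G, Integrable G P → |Ψ G| ≤ ∫ t, ‖G t‖ ∂P := by
    intro G hG
    rw [abs_le]
    refine ⟨?_, hle G hG⟩
    have h1 := hle ((-1 : ℝ) • G) (hG.smul _)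
    rw [hsmul _ _ hG] at h1
    have e : ∀ t, ‖((-1 : ℝ) • G) t‖ = ‖G t‖ := by intro t; simp
    simp only [e] at h1
    linarith
  have h0 : Ψ 0 = 0 := by
    have := hsmul 0 0 (integrable_zero _ _ _)
    simpa using this
  have hI : ∀ A, MeasurableSet A → Integrable (A.indicator G) P := fun A hA => hG.indicator hA
  have hnorm : ∀ A, MeasurableSet A → ∫ t, ‖A.indicator G t‖ ∂P = ∫ t in A, ‖G t‖ ∂P := by
    intro A hA
    rw [← integral_indicator hA]
    congr 1; ext t
    exact norm_indicator_eq_indicator_norm _ _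
  have hunion : ∀ A B, MeasurableSet A → MeasurableSet B → Disjoint A B →
      Ψ ((A ∪ B).indicator G) = Ψ (A.indicator G) + Ψ (B.indicator G) := by
    intro A B hA hB hAB
    rw [← hadd _ _ (hI A hA) (hI B hB), Set.indicator_union_of_disjoint hAB]; rfl
  let v : SignedMeasure Θ :=
    { measureOf' := fun A => if MeasurableSet A then Ψ (A.indicator G) else 0
      empty' := by simp only [MeasurableSet.empty, if_true, Set.indicator_empty]; exact h0
      not_measurable' := fun A hA => by simp [hA]
      m_iUnion' := by
        intro A hA hd
        have hU := MeasurableSet.iUnion hA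
        simp only [hA, hU, if_true]
        have hs := hasSum_integral_iUnion hA hd (hG.norm.integrableOn)
        have hfin : ∀ s : Finset ℕ,
            ∑ i ∈ s, Ψ ((A i).indicator G) = Ψ ((⋃ i ∈ s, A i).indicator G) := by
          intro s
          induction s using Finset.induction_on with
          | empty => simp; exact h0.symm
          | insert a s ha ih =>
            rw [Finset.sum_insert ha, ih, Finset.set_biUnion_insert, hunion _ _ (hA a)
              (Finset.measurableSet_biUnion _ fun i _ => hA i)]
            rw [Set.disjoint_iUnion₂_right]
            intro i hi
            exact hd (by rintro rfl; exact ha hi)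
        rw [HasSum] at hs ⊢
        rw [tendsto_iff_dist_tendsto_zero] at hs ⊢
        refine squeeze_zero (fun _ => dist_nonneg) (fun s => ?_) hs
        have hB : MeasurableSet (⋃ i ∈ s, A i) := Finset.measurableSet_biUnion _ fun i _ => hA i
        have hsub : (⋃ i ∈ s, A i) ⊆ ⋃ i, A i := Set.iUnion₂_subset_iUnion _ _
        have hD := hU.diff hB
        have e1 := hunion _ _ hB hD Set.disjoint_sdiff_right
        rw [Set.union_sdiff_cancel hsub] at e1
        rw [hfin, e1, Real.dist_eq]
        have e2 : ∫ t in ⋃ i, A i, ‖G t‖ ∂P = ∫ t in ⋃ i ∈ s, A i, ‖G t‖ ∂P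
            + ∫ t in (⋃ i, A i) \ ⋃ i ∈ s, A i, ‖G t‖ ∂P := by
          rw [← setIntegral_union Set.disjoint_sdiff_right hD hG.norm.integrableOn
            hG.norm.integrableOn, Set.union_sdiff_cancel hsub]
        have e3 : ∫ t in ⋃ i ∈ s, A i, ‖G t‖ ∂P = ∑ i ∈ s, ∫ t in A i, ‖G t‖ ∂P :=
          integral_biUnion_finset _ (fun i _ => hA i) (fun i _ j _ hij => hd hij)
            fun i _ => hG.norm.integrableOn
        have e4 := habs _ (hI _ hD)
        rw [hnorm _ hD] at e4
        rw [e2, e3, Real.dist_eq]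
        calc _ = |Ψ (((⋃ i, A i) \ ⋃ i ∈ s, A i).indicator G)| := by
              rw [← abs_neg]; congr 1; ring
          _ ≤ _ := e4
          _ ≤ |∫ t in (⋃ i, A i) \ ⋃ i ∈ s, A i, ‖G t‖ ∂P| := le_abs_self _
          _ = _ := by rw [← abs_neg]; congr 1; ring }
  have hv : ∀ A, MeasurableSet A → v A = Ψ (A.indicator G) := fun A hA => if_pos hA
  have hac : v ≪ᵥ P.toENNRealVectorMeasure := by
    intro A hA'
    by_cases hA : MeasurableSet A
    · rw [Measure.toENNRealVectorMeasure_apply_measurable hA] at hA'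
      rw [hv A hA]
      have h1 := habs _ (hI A hA)
      rw [hnorm A hA, Measure.restrict_eq_zero.2 hA', integral_zero_measure] at h1
      exact abs_nonpos_iff.1 h1
    · exact v.not_measurable hA
  refine ⟨v.rnDeriv P, SignedMeasure.measurable_rnDeriv _ _, SignedMeasure.integrable_rnDeriv _ _,
    fun A hA => ?_⟩
  rw [← hv A hA, ← withDensityᵥ_apply (SignedMeasure.integrable_rnDeriv _ _) hA,
    SignedMeasure.withDensityᵥ_rnDeriv_eq _ _ hac]

theorem exists_rademacher : ∃ (ν : Measure (ℕ → Bool)) (r : ℕ → (ℕ → Bool) → ℝ),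
    IsProbabilityMeasure ν ∧ (∀ n, Measurable (r n)) ∧ (∀ n s, r n s = 1 ∨ r n s = -1) ∧
    ∀ (h : (ℕ → Bool) → ℝ) (M : ℝ), Measurable h → (∀ᵐ s ∂ν, |h s| ≤ M) →
      Tendsto (fun n => ∫ s, h s * r n s ∂ν) atTop (𝓝 0) := by
  let p : Measure Bool := (PMF.uniformOfFintype Bool).toMeasure
  let e : Bool → ℝ := fun b => if b then 1 else -1
  have he : Measurable e := measurable_of_finite _
  let ν : Measure (ℕ → Bool) := Measure.infinitePi (fun _ : ℕ => p)
  let r : ℕ → (ℕ → Bool) → ℝ := fun n s => e (s n)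
  have hr : ∀ n, Measurable (r n) := fun n => he.comp (measurable_pi_apply n)
  have hval : ∀ n s, r n s = 1 ∨ r n s = -1 := by
    intro n s
    simp only [r, e]; split_ifs <;> simp
  have hind := ProbabilityTheory.iIndepFun_infinitePi (P := fun _ : ℕ => p) (X := fun _ => e)
    (fun _ => he)
  have hmean : ∀ n, ∫ s, r n s ∂ν = 0 := by
    intro n
    have h1 := (measurePreserving_eval_infinitePi (fun _ : ℕ => p) n).map_eq
    have h2 : ∫ s, r n s ∂ν = ∫ b, e b ∂p := by
      rw [← h1, integral_map (measurable_pi_apply n).aemeasurable he.aestronglyMeasurable]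
    rw [h2, PMF.integral_eq_sum]
    simp [e]
  have hbd : ∀ n s, ‖r n s‖ ≤ 1 := by
    intro n s; rcases hval n s with h | h <;> simp [h]
  have hLp : ∀ n, MemLp (r n) 2 ν := fun n =>
    MemLp.of_bound (hr n).aestronglyMeasurable 1 (Eventually.of_forall (hbd n))
  have hort : Orthonormal ℝ (fun n => (hLp n).toLp) := by
    classical
    rw [orthonormal_iff_ite]
    intro i j
    have h1 : inner ℝ (hLp i).toLp (hLp j).toLp = ∫ s, r i s * r j s ∂ν := by
      rw [L2.inner_def]
      refine integral_congr_ae ?_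
      filter_upwards [(hLp i).coeFn_toLp, (hLp j).coeFn_toLp] with s h1 h2
      rw [h1, h2]; simp [mul_comm]
    rw [h1]
    split_ifs with hij
    · subst hij
      have : ∀ s, r i s * r i s = 1 := by
        intro s; rcases hval i s with h | h <;> simp [h]
      simp [this]
    · have h2 : ProbabilityTheory.IndepFun (r i) (r j) ν := hind.indepFun hij
      rw [h2.integral_fun_mul_eq_mul_integral (hr i).aestronglyMeasurable
        (hr j).aestronglyMeasurable, hmean, zero_mul]
  refine ⟨ν, r, inferInstance, hr, hval, ?_⟩
  intro h M hh hM
  have hhL : MemLp h 2 ν := MemLp.of_bound hh.aestronglyMeasurable M hM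
  have h1 : ∀ n, inner ℝ (hLp n).toLp hhL.toLp = ∫ s, h s * r n s ∂ν := by
    intro n
    rw [L2.inner_def]
    refine integral_congr_ae ?_
    filter_upwards [(hLp n).coeFn_toLp, hhL.coeFn_toLp] with s h1 h2
    rw [h1, h2]; simp
  have h2 := (hort.inner_products_summable hhL.toLp).tendsto_atTop_zero
  simp only [h1] at h2
  have h3 := (Real.continuous_sqrt.tendsto 0).comp h2
  simp only [Function.comp_def, Real.sqrt_sq (norm_nonneg _), Real.sqrt_zero] at h3
  exact tendsto_zero_iff_norm_tendsto_zero.2 h3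

theorem pointwise_bound {X Δ : Type*} [NormedAddCommGroup X] [NormedSpace ℝ X]
    [MeasurableSpace Δ] (ν : Measure Δ) [IsProbabilityMeasure ν] (r : ℕ → Δ → ℝ)
    (hr : ∀ n, Measurable (r n)) (hval : ∀ n s, r n s = 1 ∨ r n s = -1)
    (hnull : ∀ (h : Δ → ℝ) (M : ℝ), Measurable h → (∀ᵐ s ∂ν, |h s| ≤ M) →
      Tendsto (fun n => ∫ s, h s * r n s ∂ν) atTop (𝓝 0))
    (ε : ℝ) (hε : 0 ≤ ε) (K : Set X) (hK : IsWeaklyPrecompactWith ε K)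
    (x : ℕ → X) (hx : ∀ n, x n ∈ K) (h : ℕ → Δ → ℝ) (hh : ∀ n, Measurable (h n))
    (hdom : ∀ᵐ s ∂ν, ∀ (m : ℕ) (a : ℕ → ℝ), ∑ n ∈ Finset.range m, a n * h n s
      ≤ ‖∑ n ∈ Finset.range m, a n • x n‖)
    (C : ℝ) (hC : ε < C) : ∀ᶠ n in atTop, ∫ s, h n s * r n s ∂ν ≤ C := by
  by_contra hcon
  rw [not_eventually] at hcon
  obtain ⟨φ, hφ, hφC⟩ := extraction_of_frequently_atTop hcon
  obtain ⟨hbK, hK⟩ := hK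
  obtain ⟨ψ, hψ, hδ⟩ := hK (fun k => x (φ k)) (fun k => hx _)
  obtain ⟨M, hM⟩ := hbK.exists_norm_le
  have hg : ∀ᵐ s ∂ν, ∃ g : X →L[ℝ] ℝ, ‖g‖ ≤ 1 ∧ ∀ n, g (x n) = h n s := by
    filter_upwards [hdom] with s hs
    obtain ⟨g, hg1, hg2⟩ := helly_ext (fun y : X => ‖y‖)
      (fun c hc y => by rw [norm_smul, Real.norm_eq_abs, abs_of_pos hc]) norm_add_le x
      (fun n => h n s) hs
    have hb : ∀ y, ‖g y‖ ≤ 1 * ‖y‖ := by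
      intro y
      rw [Real.norm_eq_abs, abs_le, one_mul]
      have h2 := hg1 (-y)
      rw [map_neg, norm_neg] at h2
      exact ⟨by linarith, hg1 y⟩
    exact ⟨g.mkContinuous 1 hb, g.mkContinuous_norm_le zero_le_one hb, hg2⟩
  let N : ℕ → ℕ := fun k => φ (ψ k)
  have hN : StrictMono N := hφ.comp hψ
  let H : ℕ → Δ → ℝ := fun k => h (N k)
  let a : Δ → ℝ := fun s => limsup (fun k => H k s) atTop
  have hH : ∀ k, Measurable (H k) := fun k => hh _
  have ha : Measurable a := Measurable.limsup hH
  have hkey : ∀ᵐ s ∂ν, (∀ k, |H k s| ≤ M) ∧ |a s| ≤ M ∧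
      ∀ η > 0, ∀ᶠ k in atTop, |H k s - a s| ≤ ε + η := by
    filter_upwards [hg] with s ⟨g, hg1, hg2⟩
    have hHM : ∀ k, |H k s| ≤ M := by
      intro k
      simp only [H]
      rw [← hg2, ← Real.norm_eq_abs]
      calc _ ≤ ‖g‖ * ‖x (N k)‖ := g.le_opNorm _
        _ ≤ 1 * ‖x (N k)‖ := by gcongr
        _ ≤ M := by rw [one_mul]; exact hM _ (hx _)
    have hd := hδ g hg1
    simp only [hg2] at hd
    change a s - liminf (fun k => H k s) atTop ≤ ε at hd
    have hle : IsBoundedUnder (· ≤ ·) atTop (fun k => H k s) :=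
      isBoundedUnder_of ⟨M, fun k => (abs_le.1 (hHM k)).2⟩
    have hge : IsBoundedUnder (· ≥ ·) atTop (fun k => H k s) :=
      isBoundedUnder_of ⟨-M, fun k => (abs_le.1 (hHM k)).1⟩
    refine ⟨hHM, abs_le.2 ⟨?_, ?_⟩, ?_⟩
    · exact le_limsup_of_frequently_le
        (Frequently.of_forall fun k => (abs_le.1 (hHM k)).1) hle
    · exact limsup_le_of_le hge.isCoboundedUnder_le
        (Eventually.of_forall fun k => (abs_le.1 (hHM k)).2)
    · intro η hη
      have h1 : ∀ᶠ k in atTop, H k s < a s + η :=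
        eventually_lt_of_limsup_lt (by change a s < _; linarith) hle
      have h2 : ∀ᶠ k in atTop, a s - ε - η < H k s :=
        eventually_lt_of_lt_liminf (by linarith) hge
      filter_upwards [h1, h2] with k h1 h2
      rw [abs_le]; constructor <;> linarith
  let J : ℕ → Δ → ℝ := fun k s => max (|H k s - a s| - ε) 0
  have hJm : ∀ k, Measurable (J k) := fun k =>
    (((hH k).sub ha).abs.sub_const ε).max measurable_const
  have hJb : ∀ k, ∀ᵐ s ∂ν, ‖J k s‖ ≤ 2 * M := by
    intro k
    filter_upwards [hkey] with s ⟨h1, h2, _⟩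
    have h3 := abs_sub (H k s) (a s)
    have h4 := h1 k
    have h5 := abs_nonneg (a s)
    rw [Real.norm_eq_abs, abs_of_nonneg (le_max_right _ _)]
    exact max_le (by linarith) (by linarith)
  have hJ : Tendsto (fun k => ∫ s, J k s ∂ν) atTop (𝓝 (∫ _, (0 : ℝ) ∂ν)) := by
    refine tendsto_integral_of_dominated_convergence (fun _ => 2 * M)
      (fun k => (hJm k).aestronglyMeasurable) (integrable_const _) hJb ?_
    filter_upwards [hkey] with s ⟨_, _, h3⟩
    rw [Metric.tendsto_nhds]
    intro η hη
    filter_upwards [h3 (η / 2) (by linarith)] with k hk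
    rw [Real.dist_eq, sub_zero, abs_of_nonneg (le_max_right _ _)]
    exact max_lt (by linarith) hη
  rw [integral_zero] at hJ
  have hA := (hnull a M ha (hkey.mono fun s hs => hs.2.1)).comp hN.tendsto_atTop
  have hlim := (hA.add_const ε).add hJ
  have hr1 : ∀ n s, |r n s| = 1 := by
    intro n s; rcases hval n s with h | h <;> simp [h]
  have hbound : ∀ k, C ≤ ∫ s, a s * r (N k) s ∂ν + ε + ∫ s, J k s ∂ν := by
    intro k
    have h1 : C < ∫ s, H k s * r (N k) s ∂ν := not_le.1 (hφC (ψ k))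
    have iA : Integrable (fun s => a s * r (N k) s) ν :=
      Integrable.of_bound (ha.mul (hr _)).aestronglyMeasurable M
        (hkey.mono fun s hs => by
          rw [norm_mul, Real.norm_eq_abs, Real.norm_eq_abs, hr1, mul_one]; exact hs.2.1)
    have iH : Integrable (fun s => H k s * r (N k) s) ν :=
      Integrable.of_bound ((hH k).mul (hr _)).aestronglyMeasurable M
        (hkey.mono fun s hs => by
          rw [norm_mul, Real.norm_eq_abs, Real.norm_eq_abs, hr1, mul_one]; exact hs.1 k)
    have iJ : Integrable (J k) ν := Integrable.of_bound (hJm k).aestronglyMeasurable _ (hJb k)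
    have h2 : ∫ s, H k s * r (N k) s ∂ν ≤ ∫ s, (a s * r (N k) s + ε + J k s) ∂ν := by
      refine integral_mono iH ((iA.add (integrable_const ε)).add iJ) fun s => ?_
      have e1 : (H k s - a s) * r (N k) s ≤ |H k s - a s| := by
        refine (le_abs_self _).trans ?_
        rw [abs_mul, hr1, mul_one]
      have e2 : |H k s - a s| - ε ≤ J k s := le_max_left _ _
      simp only
      linarith
    have iAe : Integrable (fun s => a s * r (N k) s + ε) ν := iA.add (integrable_const ε)
    rw [integral_add iAe iJ, integral_add iA (integrable_const ε)] at h2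
    simp at h2
    linarith
  have := ge_of_tendsto' hlim hbound
  simp at this
  linarith

theorem L1_norm_sum {Ω X : Type*} [MeasurableSpace Ω] [NormedAddCommGroup X] [NormedSpace ℝ X]
    (μ : Measure Ω) (f : ℕ → Lp X 1 μ) (b : ℕ → ℝ) (m : ℕ) :
    ‖∑ n ∈ Finset.range m, b n • f n‖ = ∫ ω, ‖∑ n ∈ Finset.range m, b n • f n ω‖ ∂μ := by
  rw [L1.norm_eq_integral_norm]
  have : ∀ᵐ ω ∂μ, (∑ n ∈ Finset.range m, b n • f n : Lp X 1 μ) ω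
      = ∑ n ∈ Finset.range m, b n • f n ω := by
    induction m with
    | zero =>
      simp only [Finset.range_zero, Finset.sum_empty]
      exact Lp.coeFn_zero _ _ _
    | succ m ih =>
      simp only [Finset.sum_range_succ]
      filter_upwards [ih, Lp.coeFn_add (∑ n ∈ Finset.range m, b n • f n) (b m • f m),
        Lp.coeFn_smul (b m) (f m)] with ω h1 h2 h3
      rw [h2, Pi.add_apply, h1, h3, Pi.smul_apply]
  exact integral_congr_ae (this.mono fun ω h => by simp only [h])

theorem ae_dominated {Θ X : Type*} [MeasurableSpace Θ] [NormedAddCommGroup X]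
    [NormedSpace ℝ X] (P : Measure Θ) [IsFiniteMeasure P] (Ψ : (Θ → X) → ℝ)
    (hadd : ∀ G H, Integrable G P → Integrable H P → Ψ (G + H) = Ψ G + Ψ H)
    (hsmul : ∀ (c : ℝ) G, Integrable G P → Ψ (c • G) = c * Ψ G)
    (hle : ∀ G, Integrable G P → Ψ G ≤ ∫ t, ‖G t‖ ∂P)
    (G : ℕ → Θ → X) (hG : ∀ n, Integrable (G n) P)
    (h : ℕ → Θ → ℝ) (hh : ∀ n, Integrable (h n) P)
    (hd : ∀ n A, MeasurableSet A → ∫ t in A, h n t ∂P = Ψ (A.indicator (G n))) :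
    ∀ᵐ t ∂P, ∀ (m : ℕ) (a : ℕ → ℝ), ∑ n ∈ Finset.range m, a n * h n t
      ≤ ‖∑ n ∈ Finset.range m, a n • G n t‖ := by
  have hIs : ∀ (m : ℕ) (a : ℕ → ℝ), Integrable (fun t => ∑ n ∈ Finset.range m, a n • G n t) P :=
    fun m a => integrable_finsetSum _ fun n _ => (hG n).smul (a n)
  have hIh : ∀ (m : ℕ) (a : ℕ → ℝ), Integrable (fun t => ∑ n ∈ Finset.range m, a n * h n t) P :=
    fun m a => integrable_finsetSum _ fun n _ => (hh n).const_mul (a n)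
  have h0 : Ψ 0 = 0 := by
    have := hsmul 0 0 (integrable_zero _ _ _)
    simpa using this
  have hfix : ∀ (m : ℕ) (a : ℕ → ℝ), ∀ᵐ t ∂P, ∑ n ∈ Finset.range m, a n * h n t
      ≤ ‖∑ n ∈ Finset.range m, a n • G n t‖ := by
    intro m a
    refine ae_le_of_forall_setIntegral_le (hIh m a) (hIs m a).norm ?_
    intro A hA _
    have e1 : ∫ t in A, ∑ n ∈ Finset.range m, a n * h n t ∂P
        = Ψ (A.indicator (fun t => ∑ n ∈ Finset.range m, a n • G n t)) := by
      rw [integral_finsetSum _ fun n _ => ((hh n).const_mul (a n)).integrableOn]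
      simp only [integral_const_mul, hd _ A hA]
      induction m with
      | zero =>
        simp only [Finset.range_zero, Finset.sum_empty]
        rw [Set.indicator_zero]; exact h0.symm
      | succ m ih =>
        simp only [Finset.sum_range_succ]
        rw [ih, ← hsmul _ _ ((hG m).indicator hA),
          ← hadd _ _ ((hIs m a).indicator hA) (((hG m).indicator hA).smul _)]
        congr 1
        ext t
        by_cases ht : t ∈ A <;> simp [ht]
    rw [e1]
    refine (hle _ ((hIs m a).indicator hA)).trans (le_of_eq ?_)
    rw [← integral_indicator hA]
    congr 1; ext t
    exact norm_indicator_eq_indicator_norm _ _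
  have hq : ∀ᵐ t ∂P, ∀ (m : ℕ) (q : Fin m → ℚ), ∑ n, (q n : ℝ) * h n t
      ≤ ‖∑ n, (q n : ℝ) • G n t‖ := by
    rw [ae_all_iff]; intro m
    rw [ae_all_iff]; intro q
    filter_upwards [hfix m (fun n => if hn : n < m then (q ⟨n, hn⟩ : ℝ) else 0)] with t ht
    simpa [Finset.sum_range] using ht
  filter_upwards [hq] with t ht m a
  have hdense : DenseRange (fun (q : Fin m → ℚ) (i : Fin m) => (q i : ℝ)) :=
    DenseRange.piMap (fun _ => Rat.denseRange_cast)
  have := hdense.induction_on (p := fun b : Fin m → ℝ => ∑ n, b n * h n t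
      ≤ ‖∑ n, b n • G n t‖) (fun i => a i)
    (isClosed_le (by fun_prop) (by fun_prop)) (ht m)
  simpa [Finset.sum_range] using this

theorem no_l1_seq_in_selectors
    {Ω X : Type*} [MeasurableSpace Ω] [NormedAddCommGroup X] [NormedSpace ℝ X]
    [CompleteSpace X]
    (μ : Measure Ω) [IsProbabilityMeasure μ] (ε : ℝ) (hε : 0 ≤ ε)
    (F : Ω → Set X) (hF : ∀ᵐ ω ∂μ, IsWeaklyPrecompactWith ε (F ω))
    (f : ℕ → Lp X 1 μ) (hf : ∀ n, ∀ᵐ ω ∂μ, (f n) ω ∈ F ω)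
    (hui : UnifIntegrableSet μ (Set.range f))
    (C : ℝ) (hC : ε < C) :
    ¬ IsL1SeqWith C f := by
  rintro ⟨-, hl1⟩
  obtain ⟨ν, r, hν, hr, hval, hnull⟩ := exists_rademacher
  have hr1 : ∀ n s, |r n s| = 1 := by
    intro n s; rcases hval n s with h | h <;> simp [h]
  let P : Measure (Ω × (ℕ → Bool)) := μ.prod ν
  let G : ℕ → Ω × (ℕ → Bool) → X := fun n t => f n t.1
  let Z : ℕ → Ω × (ℕ → Bool) → X := fun n t => r n t.2 • f n t.1
  have hfI : ∀ n, Integrable (f n) μ := fun n => L1.integrable_coeFn (f n)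
  have hG : ∀ n, Integrable (G n) P := fun n => (hfI n).comp_fst ν
  have hZ : ∀ n, Integrable (Z n) P := by
    intro n
    refine (hG n).mono ?_ (Eventually.of_forall fun t => ?_)
    · exact ((hr n).comp measurable_snd).aestronglyMeasurable.smul (hG n).aestronglyMeasurable
    · simp only [Z, G, norm_smul, Real.norm_eq_abs, hr1, one_mul, le_refl]
  have hlow : ∀ (m : ℕ) (a : ℕ → ℝ), C * ∑ n ∈ Finset.range m, |a n|
      ≤ ∫ t, ‖∑ n ∈ Finset.range m, a n • Z n t‖ ∂P := by
    intro m a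
    have hI : Integrable (fun t => ‖∑ n ∈ Finset.range m, a n • Z n t‖) P :=
      (integrable_finsetSum _ fun n _ => (hZ n).smul (a n)).norm
    rw [integral_prod_symm _ hI]
    calc C * ∑ n ∈ Finset.range m, |a n|
        = ∫ _, C * ∑ n ∈ Finset.range m, |a n| ∂ν := by simp
      _ ≤ _ := by
        refine integral_mono (integrable_const _) hI.integral_prod_right fun s => ?_
        have h1 := hl1 m (fun n => a n * r n s)
        rw [L1_norm_sum] at h1
        simp only [abs_mul, hr1, mul_one] at h1
        simpa only [Z, smul_smul] using h1
  obtain ⟨Ψ, hadd, hsmul, hle, hΨ⟩ := exists_functional P Z hZ C (hε.trans hC.le) hlow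
  choose h hhm hhI hd using fun n => exists_density P Ψ hadd hsmul hle (G n) (hG n)
  have hdom := ae_dominated P Ψ hadd hsmul hle G hG h hhI hd
  have hdom' : ∀ᵐ ω ∂μ, ∀ᵐ s ∂ν, ∀ (m : ℕ) (a : ℕ → ℝ), ∑ n ∈ Finset.range m, a n * h n (ω, s)
      ≤ ‖∑ n ∈ Finset.range m, a n • f n ω‖ := Measure.ae_ae_of_ae_prod hdom
  obtain ⟨C', hC1, hC2⟩ := exists_between hC
  let u : ℕ → Ω → ℝ := fun n ω => ∫ s, h n (ω, s) * r n s ∂ν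
  have hhr : ∀ n, Measurable (fun t : Ω × (ℕ → Bool) => h n t * r n t.2) := fun n =>
    (hhm n).mul ((hr n).comp measurable_snd)
  have hum : ∀ n, Measurable (u n) := fun n =>
    ((hhr n).stronglyMeasurable.integral_prod_right' (ν := ν)).measurable
  have hev : ∀ᵐ ω ∂μ, ∀ᶠ n in atTop, u n ω ≤ C' := by
    filter_upwards [hdom', hF, ae_all_iff.2 hf] with ω h1 h2 h3
    exact pointwise_bound ν r hr hval hnull ε hε (F ω) h2 (fun n => f n ω) h3
      (fun n s => h n (ω, s)) (fun n => (hhm n).comp measurable_prodMk_left) h1 C' hC1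
  have hub : ∀ n, ∀ᵐ ω ∂μ, |u n ω| ≤ ‖f n ω‖ := by
    intro n
    filter_upwards [hdom'] with ω h1
    have h2 : ∀ᵐ s ∂ν, ‖h n (ω, s) * r n s‖ ≤ ‖f n ω‖ := by
      filter_upwards [h1] with s hs
      rw [norm_mul, Real.norm_eq_abs, Real.norm_eq_abs, hr1, mul_one]
      have e1 := hs (n + 1) (Pi.single n 1)
      have e2 := hs (n + 1) (Pi.single n (-1))
      simp [Finset.sum_range_succ, Pi.single_apply, Finset.sum_ite_eq] at e1 e2
      rw [abs_le]; constructor <;> linarith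
    have h3 := norm_integral_le_of_norm_le_const h2
    simpa using h3
  have huI : ∀ n, Integrable (u n) μ := fun n =>
    (hfI n).mono (hum n).aestronglyMeasurable (hub n)
  have huC : ∀ n, ∫ ω, u n ω ∂μ = C := by
    intro n
    have hI : Integrable (fun t : Ω × (ℕ → Bool) => h n t * r n t.2) P := by
      refine (hhI n).mono (hhr n).aestronglyMeasurable (Eventually.of_forall fun t => ?_)
      rw [norm_mul, Real.norm_eq_abs (r n t.2), hr1, mul_one]
    have e1 : ∫ ω, u n ω ∂μ = ∫ t, h n t * r n t.2 ∂P := (integral_prod _ hI).symm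
    let A : Set (Ω × (ℕ → Bool)) := {t | r n t.2 = 1}
    have hA : MeasurableSet A := ((hr n).comp measurable_snd) (measurableSet_singleton 1)
    rw [e1, ← integral_add_compl hA hI,
      setIntegral_congr_fun (g := h n) hA (fun t (ht : r n t.2 = 1) => by simp [ht]),
      setIntegral_congr_fun (g := fun t => (-1) * h n t) hA.compl
        (fun t (ht : ¬ r n t.2 = 1) => by simp [(hval n t.2).resolve_left ht]),
      integral_const_mul, hd n A hA, hd n Aᶜ hA.compl,
      ← hsmul _ _ ((hG n).indicator hA.compl),
      ← hadd _ _ ((hG n).indicator hA) (((hG n).indicator hA.compl).smul _), ← hΨ n]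
    congr 1
    ext t
    by_cases ht : r n t.2 = 1
    · have h1 : t ∈ A := ht
      simp [h1, Z, G, ht]
    · have h1 : t ∉ A := ht
      simp [h1, Z, G, (hval n t.2).resolve_left ht]
  obtain ⟨-, hui⟩ := hui
  obtain ⟨δ, hδ, hδ'⟩ := hui ((C - C') / 2) (by linarith)
  let B : ℕ → Set Ω := fun N => ⋃ n ≥ N, {ω | C' < u n ω}
  have hBm : ∀ N, MeasurableSet (B N) := fun N =>
    MeasurableSet.iUnion fun n => MeasurableSet.iUnion fun _ =>
      measurableSet_lt measurable_const (hum n)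
  have hBanti : Antitone B := by
    intro N M hNM
    exact Set.iUnion₂_subset fun n hn => Set.subset_iUnion₂_of_subset n (le_trans hNM hn) le_rfl
  have hB0 : μ (⋂ N, B N) = 0 := by
    refine measure_mono_null ?_ (ae_iff.1 hev)
    intro ω hω hω'
    obtain ⟨N, hN⟩ := eventually_atTop.1 hω'
    have := Set.mem_iInter.1 hω N
    simp only [B, Set.mem_iUnion, Set.mem_setOf_eq] at this
    obtain ⟨n, hn, hlt⟩ := this
    exact absurd (hN n hn) (not_le.2 hlt)
  have hBt := tendsto_measure_iInter_atTop (μ := μ) (fun N => (hBm N).nullMeasurableSet) hBanti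
    ⟨0, measure_ne_top _ _⟩
  rw [hB0] at hBt
  obtain ⟨N, hN⟩ := (hBt.eventually_lt_const (ENNReal.ofReal_pos.2 hδ)).exists
  have h1 := hδ' (f N) ⟨N, rfl⟩ (B N) (hBm N) hN.le
  have h2 : ∫ ω in B N, u N ω ∂μ ≤ ∫ ω in B N, ‖f N ω‖ ∂μ :=
    setIntegral_mono_ae (huI N).integrableOn (hfI N).norm.integrableOn
      ((hub N).mono fun ω hω => (le_abs_self _).trans hω)
  have h3 : ∫ ω in (B N)ᶜ, u N ω ∂μ ≤ ∫ ω in (B N)ᶜ, C' ∂μ := by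
    refine setIntegral_mono_on (huI N).integrableOn (integrable_const _).integrableOn
      (hBm N).compl fun ω hω => ?_
    by_contra hcon
    exact hω (Set.mem_iUnion₂.2 ⟨N, le_rfl, not_le.1 hcon⟩)
  have h4 : ∫ ω in (B N)ᶜ, C' ∂μ ≤ C' := by
    rw [setIntegral_const, smul_eq_mul]
    exact mul_le_of_le_one_left (hε.trans hC1.le) measureReal_le_one
  have h5 := integral_add_compl (hBm N) (huI N)
  rw [huC N] at h5
  linarith
end

section
/- Let (Ω,Σ,μ) be a probability space, X a real Banach space, and ε ≥ 0. Let F : Ω → P(X) be a multi-function such that F(ω) is ε-weakly precompact for μ-a.e. ω ∈ Ω, and let S₁(F) denote the set of all (equivalence classes of) Bochner μ-integrable functions f : Ω → X with f(ω) ∈ F(ω) for μ-a.e. ω. Then every uniformly integrable subset of S₁(F) is 2ε-weakly precompact in L¹(μ,X). -/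
open Filter Topology MeasureTheory

theorem aux_diag {S : Type*} (P : S → Prop) (M : S → Set ℕ) (R : S → ℕ → S → Prop)
    (step : ∀ s, P s → ∃ n ∈ M s, ∃ t, P t ∧ R s n t ∧ M t ⊆ M s ∩ Set.Ioi n)
    (s0 : S) (h0 : P s0) :
    ∃ (s : ℕ → S) (n : ℕ → ℕ), s 0 = s0 ∧ (∀ k, P (s k)) ∧ (∀ k, R (s k) (n k) (s (k+1))) ∧
      StrictMono n ∧ ∀ k j, k ≤ j → n j ∈ M (s k) := by
  choose! n hn t hP hR hM using step
  let s : ℕ → S := fun k => Nat.rec s0 (fun _ x => t x) k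
  have hs : ∀ k, P (s k) := by
    intro k
    induction k with
    | zero => exact h0
    | succ k ih => exact hP _ ih
  have hanti : ∀ k j, k ≤ j → M (s j) ⊆ M (s k) := by
    intro k j hkj
    induction j, hkj using Nat.le_induction with
    | base => exact subset_rfl
    | succ j _ ih => exact ((hM _ (hs j)).trans Set.inter_subset_left).trans ih
  refine ⟨s, fun k => n (s k), rfl, hs, fun k => hR _ (hs k), ?_, ?_⟩
  · apply strictMono_nat_of_lt_succ
    intro k
    exact (hM _ (hs k) (hn _ (hs (k+1)))).2
  · intro k j hkj
    exact hanti k j hkj (hn _ (hs j))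

/-- `K'` is good for `M`. -/
def AuxGood {K : Type*} (A : Bool → ℕ → Set K) (K' : Set K) (M : Set ℕ) : Prop :=
  ∀ L ⊆ M, L.Infinite → ∃ g ∈ K', ∀ e, {n | n ∈ L ∧ g ∈ A e n}.Infinite

theorem aux_step {K : Type*} (A : Bool → ℕ → Set K) (C : Set (Set K)) (hC : C.Finite)
    (M : Set ℕ) (hM : M.Infinite) (hg : ∀ K' ∈ C, AuxGood A K' M) :
    ∃ n ∈ M, ∃ M' : Set ℕ, M'.Infinite ∧ M' ⊆ M ∩ Set.Ioi n ∧
      ∀ K' ∈ C, ∀ e, AuxGood A (K' ∩ A e n) M' := by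
  by_contra hcon
  push Not at hcon
  -- states: infinite subset of M
  have key := aux_diag (S := Set ℕ) (fun s => s.Infinite ∧ s ⊆ M) id
    (fun _ n t => ∃ c : C × Bool, ∀ g ∈ (c.1 : Set K) ∩ A c.2 n,
      ∃ e, ¬ {m | m ∈ t ∧ g ∈ A e m}.Infinite) ?_ M ⟨hM, subset_rfl⟩
  · obtain ⟨s, n, hs0, hP, hR, hn, hmem⟩ := key
    choose c hc using hR
    have : Finite C := hC
    obtain ⟨y, hy⟩ := Finite.exists_infinite_fiber c
    have hinf : (c ⁻¹' {y}).Infinite := Set.infinite_coe_iff.mp hy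
    have hLinf : (n '' (c ⁻¹' {y})).Infinite := hinf.image hn.injective.injOn
    have hLM : n '' (c ⁻¹' {y}) ⊆ M := by
      rintro _ ⟨k, _, rfl⟩
      have := hmem 0 k (Nat.zero_le _)
      rw [hs0] at this
      exact this
    obtain ⟨g, hgK, hgi⟩ := hg y.1 y.1.2 _ hLM hLinf
    obtain ⟨m, ⟨k, hk, rfl⟩, hgm⟩ := (hgi y.2).nonempty
    have hk' : c k = y := hk
    obtain ⟨e, he⟩ := hc k g (by rw [hk']; exact ⟨hgK, hgm⟩)
    apply he
    have h1 := (hgi e).sdiff (Set.finite_Iic (n k))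
    refine h1.mono ?_
    rintro _ ⟨⟨⟨j, hj, rfl⟩, hjA⟩, hjk⟩
    refine ⟨hmem (k+1) j ?_, hjA⟩
    have : n k < n j := by simpa using hjk
    exact hn.lt_iff_lt.mp this
  · rintro s ⟨hs, hsM⟩
    obtain ⟨n, hn⟩ := hs.nonempty
    have h1 : (s ∩ Set.Ioi n).Infinite := by
      have := hs.sdiff (Set.finite_Iic n)
      refine this.mono ?_
      rintro x ⟨hx, hx2⟩
      exact ⟨hx, by simpa using hx2⟩
    obtain ⟨K', hK', e, he⟩ := hcon n (hsM hn) _ h1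
      (Set.inter_subset_inter_left _ hsM)
    unfold AuxGood at he
    push Not at he
    obtain ⟨L, hL, hLi, hLg⟩ := he
    refine ⟨n, hn, L, ⟨hLi, (hL.trans Set.inter_subset_left).trans hsM⟩,
      ⟨(⟨K', hK'⟩, e), ?_⟩, hL⟩
    intro g hg
    obtain ⟨e', he'⟩ := hLg g hg
    exact ⟨e', by simpa using he'⟩

theorem aux_indep {K : Type*} (A : Bool → ℕ → Set K) (M : Set ℕ) (hM : M.Infinite)
    (hg : AuxGood A Set.univ M) :
    ∃ n : ℕ → ℕ, StrictMono n ∧ ∀ (N : ℕ) (d : ℕ → Bool), ∃ g, ∀ k < N, g ∈ A (d k) (n k) := by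
  have key := aux_diag (S := Set (Set K) × Set ℕ)
    (fun s => s.1.Finite ∧ s.2.Infinite ∧ ∀ K' ∈ s.1, AuxGood A K' s.2) Prod.snd
    (fun s n t => ∀ K' ∈ s.1, ∀ e, K' ∩ A e n ∈ t.1) ?_ ({Set.univ}, M)
    ⟨Set.finite_singleton _, hM, by simpa using hg⟩
  · obtain ⟨s, n, hs0, hP, hR, hn, hmem⟩ := key
    refine ⟨n, hn, fun N d => ?_⟩
    have : ∀ N, {g | ∀ k < N, g ∈ A (d k) (n k)} ∈ (s N).1 := by
      intro N
      induction N with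
      | zero => simp [hs0]
      | succ N ih =>
        have := hR N _ ih (d N)
        convert this using 1
        ext g
        simp only [Set.mem_ofPred_eq, Set.mem_inter_iff, Nat.lt_succ_iff_lt_or_eq]
        constructor
        · intro h
          exact ⟨fun k hk => h k (Or.inl hk), h N (Or.inr rfl)⟩
        · rintro ⟨h1, h2⟩ k (hk | rfl)
          · exact h1 k hk
          · exact h2
    obtain ⟨g, hg, -⟩ := (hP N).2.2 _ (this N) _ subset_rfl (hP N).2.1
    exact ⟨g, hg⟩
  · rintro ⟨C, L⟩ ⟨hC, hL, hgood⟩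
    obtain ⟨n, hn, M', hM', hsub, h⟩ := aux_step A C hC L hL hgood
    refine ⟨n, hn, ((fun p : Set K × Bool => p.1 ∩ A p.2 n) '' (C ×ˢ Set.univ), M'),
      ⟨(hC.prod Set.finite_univ).image _, hM', ?_⟩, ?_, hsub⟩
    · rintro _ ⟨⟨K', e⟩, ⟨hK', -⟩, rfl⟩
      exact h K' hK' e
    · intro K' hK' e
      exact ⟨(K', e), ⟨hK', trivial⟩, rfl⟩

/-- countably many families: one is good on some infinite set. -/
theorem aux_pigeon {K I : Type*} [Countable I] [Nonempty I] (A : I → Bool → ℕ → Set K)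
    (h : ∀ L : Set ℕ, L.Infinite → ∃ i, ∃ g, ∀ e, {n | n ∈ L ∧ g ∈ A i e n}.Infinite) :
    ∃ i, ∃ M : Set ℕ, M.Infinite ∧ AuxGood (A i) Set.univ M := by
  by_contra hcon
  push Not at hcon
  obtain ⟨q, hq⟩ := exists_surjective_nat I
  have key := aux_diag (S := ℕ × Set ℕ) (fun s => s.2.Infinite) Prod.snd
    (fun s _ t => t.1 = s.1 + 1 ∧ ∀ g, ∃ e, ¬ {m | m ∈ t.2 ∧ g ∈ A (q s.1) e m}.Infinite) ?_
    (0, Set.univ) Set.infinite_univ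
  · obtain ⟨s, n, hs0, hP, hR, hn, hmem⟩ := key
    have hs1 : ∀ k, (s k).1 = k := by
      intro k
      induction k with
      | zero => simp [hs0]
      | succ k ih => rw [(hR k).1, ih]
    obtain ⟨i, g, hg⟩ := h (Set.range n) (Set.infinite_range_of_injective hn.injective)
    obtain ⟨k, rfl⟩ := hq i
    obtain ⟨e, he⟩ := (hR k).2 g
    rw [hs1 k] at he
    apply he
    have h1 := (hg e).sdiff (Set.finite_Iic (n k))
    refine h1.mono ?_
    rintro _ ⟨⟨⟨j, rfl⟩, hjA⟩, hjk⟩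
    refine ⟨hmem (k+1) j ?_, hjA⟩
    have : n k < n j := by simpa using hjk
    exact hn.lt_iff_lt.mp this
  · rintro ⟨k, s⟩ hs
    obtain ⟨n, hn⟩ := Set.Infinite.nonempty hs
    have h1 : (s ∩ Set.Ioi n).Infinite := by
      have := Set.Infinite.sdiff hs (Set.finite_Iic n)
      refine this.mono ?_
      rintro x ⟨hx, hx2⟩
      exact ⟨hx, by simpa using hx2⟩
    have he := hcon (q k) _ h1
    unfold AuxGood at he
    push Not at he
    obtain ⟨L, hL, hLi, hLg⟩ := he
    refine ⟨n, hn, (k+1, L), hLi, ⟨rfl, ?_⟩, hL⟩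
    intro g
    obtain ⟨e', he'⟩ := hLg g trivial
    exact ⟨e', by simpa using he'⟩

theorem aux_rosenthal {E : Type*} [NormedAddCommGroup E] [NormedSpace ℝ E] (x : ℕ → E) (C : ℝ)
    (hC : ∀ n, ‖x n‖ ≤ C) (c : ℝ)
    (h : ∀ φ : ℕ → ℕ, StrictMono φ → ¬ DeltaLE (fun k => x (φ k)) c) :
    ∃ n : ℕ → ℕ, StrictMono n ∧ ∃ a b : ℝ, c < b - a ∧ ∀ (N : ℕ) (d : ℕ → Bool),
      ∃ g : E →L[ℝ] ℝ, ‖g‖ ≤ 1 ∧ ∀ k < N, (d k = true → b < g (x (n k))) ∧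
        (d k = false → g (x (n k)) < a) := by
  let I := {p : ℚ × ℚ // c < (p.2 : ℝ) - p.1}
  have : Nonempty I := by
    obtain ⟨q, hq⟩ := exists_rat_gt c
    exact ⟨⟨(0, q), by simpa using hq⟩⟩
  let A : I → Bool → ℕ → Set {g : E →L[ℝ] ℝ // ‖g‖ ≤ 1} := fun i e n =>
    {g | (e = true → (i.1.2 : ℝ) < g.1 (x n)) ∧ (e = false → g.1 (x n) < i.1.1)}
  obtain ⟨i, M, hM, hgood⟩ := aux_pigeon A (by
    intro L hL
    have hφ := Nat.nth_strictMono (p := (· ∈ L)) hL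
    have hmem : ∀ k, Nat.nth (· ∈ L) k ∈ L := fun k => Nat.nth_mem_of_infinite hL k
    have h1 := h _ hφ
    unfold DeltaLE at h1
    push Not at h1
    obtain ⟨g, hg, hlt⟩ := h1
    set u : ℕ → ℝ := fun n => g (x (Nat.nth (· ∈ L) n)) with hu
    have hub : ∀ n, |u n| ≤ C := by
      intro n
      calc |u n| ≤ ‖g‖ * ‖x (Nat.nth (· ∈ L) n)‖ := g.le_opNorm _
        _ ≤ 1 * C := by gcongr; exact hC _
        _ = C := one_mul _
    have hb1 : IsBoundedUnder (· ≤ ·) atTop u := isBoundedUnder_of ⟨C, fun n => (abs_le.1 (hub n)).2⟩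
    have hb2 : IsBoundedUnder (· ≥ ·) atTop u := isBoundedUnder_of ⟨-C, fun n => (abs_le.1 (hub n)).1⟩
    obtain ⟨b, hb, hb'⟩ := exists_rat_btwn (show liminf u atTop + c < limsup u atTop by linarith)
    obtain ⟨a, ha, ha'⟩ := exists_rat_btwn (show liminf u atTop < b - c by linarith)
    have f1 : ∃ᶠ n in atTop, (b : ℝ) < u n := frequently_lt_of_lt_limsup hb2.isCoboundedUnder_le hb'
    have f2 : ∃ᶠ n in atTop, u n < (a : ℝ) := frequently_lt_of_liminf_lt hb1.isCoboundedUnder_ge ha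
    refine ⟨⟨(a, b), by simp; linarith⟩, ⟨g, hg⟩, ?_⟩
    intro e
    cases e with
    | true =>
      refine ((Nat.frequently_atTop_iff_infinite.1 f1).image hφ.injective.injOn).mono ?_
      rintro _ ⟨k, hk, rfl⟩
      exact ⟨hmem k, fun _ => hk, fun h => by simp at h⟩
    | false =>
      refine ((Nat.frequently_atTop_iff_infinite.1 f2).image hφ.injective.injOn).mono ?_
      rintro _ ⟨k, hk, rfl⟩
      exact ⟨hmem k, fun h => by simp at h, fun _ => hk⟩)
  obtain ⟨n, hn, hind⟩ := aux_indep (A i) M hM hgood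
  refine ⟨n, hn, i.1.1, i.1.2, i.2, fun N d => ?_⟩
  obtain ⟨g, hg⟩ := hind N d
  exact ⟨g.1, g.2, hg⟩

theorem aux_helly {X : Type*} [NormedAddCommGroup X] [NormedSpace ℝ X] (x : ℕ → X) (h : ℕ → ℝ)
    (H : ∀ (N : ℕ) (q : Fin N → ℚ), ∑ i, (q i : ℝ) * h i ≤ ‖∑ i, (q i : ℝ) • x i‖) :
    ∃ g : X →L[ℝ] ℝ, ‖g‖ ≤ 1 ∧ ∀ i, g (x i) = h i := by
  have H1 : ∀ (N : ℕ) (q : Fin N → ℝ), ∑ i, q i * h i ≤ ‖∑ i, q i • x i‖ := by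
    intro N
    have hd : DenseRange (fun q : Fin N → ℚ => fun i => (q i : ℝ)) :=
      DenseRange.piMap (fun _ => Rat.denseRange_cast)
    intro q
    refine hd.induction_on q ?_ ?_
    · exact isClosed_le (by fun_prop) (by fun_prop)
    · intro a
      exact H N a
  let T : (ℕ →₀ ℝ) →ₗ[ℝ] X := Finsupp.linearCombination ℝ x
  let S : (ℕ →₀ ℝ) →ₗ[ℝ] ℝ := Finsupp.linearCombination ℝ h
  have H2 : ∀ v, S v ≤ ‖T v‖ := by
    intro v
    obtain ⟨N, hN⟩ : ∃ N, v.support ⊆ Finset.range N := v.support.exists_nat_subset_range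
    have e1 : S v = ∑ i : Fin N, v i * h i := by
      rw [Fin.sum_univ_eq_sum_range (fun i => v i * h i)]
      simp only [S, Finsupp.linearCombination_apply, smul_eq_mul]
      exact Finsupp.sum_of_support_subset _ hN _ (by simp)
    have e2 : T v = ∑ i : Fin N, v i • x i := by
      rw [Fin.sum_univ_eq_sum_range (fun i => v i • x i)]
      simp only [T, Finsupp.linearCombination_apply]
      exact Finsupp.sum_of_support_subset _ hN _ (by simp)
    rw [e1, e2]
    exact H1 N (fun i => v i)
  have H3 : ∀ v, |S v| ≤ ‖T v‖ := by
    intro v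
    rw [abs_le]
    have := H2 (-v)
    simp only [map_neg, norm_neg] at this
    exact ⟨by linarith, H2 v⟩
  obtain ⟨s, hs⟩ := LinearMap.exists_rightInverse_of_surjective T.rangeRestrict
    (LinearMap.range_rangeRestrict T)
  have hs' : ∀ y : LinearMap.range T, T (s y) = y := by
    intro y
    have := congrArg Subtype.val (LinearMap.congr_fun hs y)
    simpa using this
  let f : LinearMap.range T →L[ℝ] ℝ := (S.comp s).mkContinuous 1 (by
    intro y
    have := H3 (s y)
    rw [hs'] at this
    simpa using this)
  obtain ⟨g, hg, hgn⟩ := exists_extension_norm_eq (LinearMap.range T) f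
  refine ⟨g, hgn ▸ LinearMap.mkContinuous_norm_le _ zero_le_one _, fun i => ?_⟩
  have hx : x i = T (Finsupp.single i 1) := by simp [T]
  have h1 : g (x i) = f ⟨x i, ⟨_, hx.symm⟩⟩ := hg ⟨x i, ⟨_, hx.symm⟩⟩
  have h2 : f ⟨x i, ⟨_, hx.symm⟩⟩ = S (s ⟨x i, ⟨_, hx.symm⟩⟩) := rfl
  have h3 := H3 (s ⟨x i, ⟨_, hx.symm⟩⟩ - Finsupp.single i 1)
  have h5 : T (s ⟨x i, ⟨_, hx.symm⟩⟩) - T (Finsupp.single i 1) = 0 := by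
    rw [hs']
    exact sub_eq_zero.2 hx
  rw [map_sub, map_sub, h5, norm_zero] at h3
  have h4 : S (Finsupp.single i 1) = h i := by simp [S]
  rw [h1, h2]
  rw [h4] at h3
  exact sub_eq_zero.1 (abs_eq_zero.1 (le_antisymm h3 (abs_nonneg _)))

open Classical in
/-- apply a functional on `L¹` to a function. -/
noncomputable def auxG {Ω X : Type*} [MeasurableSpace Ω] [NormedAddCommGroup X] [NormedSpace ℝ X]
    {ν : Measure Ω} (G : Lp X 1 ν →L[ℝ] ℝ) (v : Ω → X) : ℝ :=
  if hv : Integrable v ν then G (hv.toL1 v) else 0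

section
variable {Ω X : Type*} [MeasurableSpace Ω] [NormedAddCommGroup X] [NormedSpace ℝ X]
    {ν : Measure Ω} (G : Lp X 1 ν →L[ℝ] ℝ)

theorem auxG_eq {v : Ω → X} (hv : Integrable v ν) : auxG G v = G (hv.toL1 v) := by
  simp [auxG, hv]

theorem auxG_add {v w : Ω → X} (hv : Integrable v ν) (hw : Integrable w ν) :
    auxG G (v + w) = auxG G v + auxG G w := by
  rw [auxG_eq G hv, auxG_eq G hw, auxG_eq G (hv.add hw), Integrable.toL1_add, map_add]

theorem auxG_sub {v w : Ω → X} (hv : Integrable v ν) (hw : Integrable w ν) :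
    auxG G (v - w) = auxG G v - auxG G w := by
  rw [auxG_eq G hv, auxG_eq G hw, auxG_eq G (hv.sub hw), Integrable.toL1_sub, map_sub]

theorem auxG_smul (c : ℝ) {v : Ω → X} (hv : Integrable v ν) :
    auxG G (c • v) = c * auxG G v := by
  rw [auxG_eq G hv, auxG_eq G (hv.smul c), Integrable.toL1_smul', map_smul, smul_eq_mul]

theorem auxG_zero : auxG G 0 = 0 := by
  rw [auxG_eq G (integrable_zero Ω X ν)]
  rw [show (integrable_zero Ω X ν).toL1 0 = 0 from Integrable.toL1_zero _, map_zero]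

theorem auxG_sum {ι : Type*} (s : Finset ι) (v : ι → Ω → X) (hv : ∀ i, Integrable (v i) ν) :
    auxG G (∑ i ∈ s, v i) = ∑ i ∈ s, auxG G (v i) := by
  classical
  induction s using Finset.induction_on with
  | empty => simp [auxG_zero]
  | insert a s ha ih =>
    rw [Finset.sum_insert ha, Finset.sum_insert ha, auxG_add G (hv a), ih]
    exact integrable_finsetSum' _ (fun i _ => hv i)

theorem auxG_le {v : Ω → X} (hv : Integrable v ν) : |auxG G v| ≤ ‖G‖ * ∫ ω, ‖v ω‖ ∂ν := by
  rw [auxG_eq G hv, ← L1.norm_of_fun_eq_integral_norm]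
  exact G.le_opNorm _

theorem aux_density [IsFiniteMeasure ν] {u : Ω → X} (hu : Integrable u ν) :
    ∃ h : Ω → ℝ, Measurable h ∧ Integrable h ν ∧
      ∀ A, MeasurableSet A → auxG G (A.indicator u) = ∫ ω in A, h ω ∂ν := by
  classical
  have hn : ∀ A, MeasurableSet A → |auxG G (A.indicator u)| ≤ ‖G‖ * ∫ ω in A, ‖u ω‖ ∂ν := by
    intro A hA
    refine (auxG_le G (hu.indicator hA)).trans_eq ?_
    simp_rw [norm_indicator_eq_indicator_norm]
    rw [integral_indicator hA]
  let m : SignedMeasure Ω :=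
    { measureOf' := fun A => if MeasurableSet A then auxG G (A.indicator u) else 0
      empty' := by
        simp only [MeasurableSet.empty, if_true, Set.indicator_empty]
        exact auxG_zero G
      not_measurable' := fun A hA => by simp [hA]
      m_iUnion' := by
        intro f hf hd
        simp only [hf, MeasurableSet.iUnion hf, if_true]
        have h1 := hasSum_integral_iUnion hf hd (hu.norm.integrableOn (s := ⋃ i, f i))
        unfold HasSum at h1 ⊢
        rw [tendsto_iff_norm_sub_tendsto_zero] at h1 ⊢
        have h2 := h1.const_mul ‖G‖
        rw [mul_zero] at h2
        refine squeeze_zero (fun _ => norm_nonneg _) (fun s => ?_) h2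
        have hU : MeasurableSet (⋃ i ∈ s, f i) := Finset.measurableSet_biUnion _ (fun i _ => hf i)
        have hsub : (⋃ i ∈ s, f i) ⊆ ⋃ i, f i := Set.iUnion₂_subset (fun i _ => Set.subset_iUnion f i)
        have e1 : ∑ i ∈ s, auxG G ((f i).indicator u) = auxG G ((⋃ i ∈ s, f i).indicator u) := by
          rw [← auxG_sum G s _ (fun i => hu.indicator (hf i))]
          congr 1
          ext ω
          rw [Finset.sum_apply, Finset.indicator_biUnion_apply]
          exact fun i _ j _ hij => hd hij
        have e2 : auxG G ((⋃ i, f i).indicator u) - auxG G ((⋃ i ∈ s, f i).indicator u)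
            = auxG G (((⋃ i, f i) \ (⋃ i ∈ s, f i)).indicator u) := by
          rw [← auxG_sub G (hu.indicator (MeasurableSet.iUnion hf)) (hu.indicator hU),
            Set.indicator_sdiff hsub]
        have e3 : ∑ i ∈ s, ∫ ω in f i, ‖u ω‖ ∂ν = ∫ ω in ⋃ i ∈ s, f i, ‖u ω‖ ∂ν := by
          rw [integral_biUnion_finset s (fun i _ => hf i) (fun i _ j _ hij => hd hij)]
          exact fun i _ => hu.norm.integrableOn
        have e4 : ∫ ω in (⋃ i, f i) \ (⋃ i ∈ s, f i), ‖u ω‖ ∂ν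
            = ∫ ω in ⋃ i, f i, ‖u ω‖ ∂ν - ∫ ω in ⋃ i ∈ s, f i, ‖u ω‖ ∂ν :=
          setIntegral_sdiff hU hu.norm.integrableOn hsub
        rw [e1, e3, norm_sub_rev, e2, norm_sub_rev, ← e4]
        refine (hn _ ((MeasurableSet.iUnion hf).diff hU)).trans ?_
        gcongr
        exact le_abs_self _ }
  have hm : ∀ A, MeasurableSet A → m A = auxG G (A.indicator u) := by
    intro A hA
    change (if MeasurableSet A then auxG G (A.indicator u) else 0) = _
    simp [hA]
  have hac : VectorMeasure.AbsolutelyContinuous m ν.toENNRealVectorMeasure := by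
    refine VectorMeasure.AbsolutelyContinuous.mk fun A hA h0 => ?_
    rw [Measure.toENNRealVectorMeasure_apply_measurable hA] at h0
    rw [hm A hA]
    have := hn A hA
    rw [Measure.restrict_eq_zero.2 h0] at this
    simpa using this
  refine ⟨m.rnDeriv ν, SignedMeasure.measurable_rnDeriv _ _, SignedMeasure.integrable_rnDeriv _ _, ?_⟩
  intro A hA
  rw [← hm A hA]
  conv_lhs => rw [← SignedMeasure.withDensityᵥ_rnDeriv_eq m ν hac]
  rw [withDensityᵥ_apply (SignedMeasure.integrable_rnDeriv _ _) hA]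

theorem aux_density_seq [IsFiniteMeasure ν] (hG : ‖G‖ ≤ 1) (u : ℕ → Ω → X)
    (hu : ∀ i, Integrable (u i) ν) :
    ∃ h : ℕ → Ω → ℝ, (∀ i, Measurable (h i)) ∧ (∀ i, Integrable (h i) ν) ∧
      (∀ i A, MeasurableSet A → auxG G (A.indicator (u i)) = ∫ ω in A, h i ω ∂ν) ∧
      ∀ᵐ ω ∂ν, ∃ g : X →L[ℝ] ℝ, ‖g‖ ≤ 1 ∧ ∀ i, g (u i ω) = h i ω := by
  choose h hm hi hA using fun i => aux_density G (hu i)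
  refine ⟨h, hm, hi, hA, ?_⟩
  have key : ∀ (N : ℕ) (q : Fin N → ℚ), ∀ᵐ ω ∂ν,
      ∑ i, (q i : ℝ) * h i ω ≤ ‖∑ i, (q i : ℝ) • u i ω‖ := by
    intro N q
    have I1 : Integrable (fun ω => ∑ i, (q i : ℝ) * h i ω) ν :=
      integrable_finsetSum _ (fun i _ => (hi i).const_mul _)
    have I2 : Integrable (fun ω => ∑ i, (q i : ℝ) • u i ω) ν :=
      integrable_finsetSum _ (fun i _ => (hu i).smul (q i : ℝ))
    refine ae_le_of_forall_setIntegral_le I1 I2.norm fun A hAm _ => ?_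
    have e1 : ∫ ω in A, ∑ i, (q i : ℝ) * h i ω ∂ν
        = auxG G (A.indicator (fun ω => ∑ i, (q i : ℝ) • u i ω)) := by
      rw [integral_finsetSum (μ := ν.restrict A) Finset.univ
        (f := fun (i : Fin N) ω => (q i : ℝ) * h i ω)
        (fun i _ => ((hi i).const_mul (q i : ℝ)).integrableOn)]
      have : A.indicator (fun ω => ∑ i, (q i : ℝ) • u i ω)
          = ∑ i, (q i : ℝ) • A.indicator (u i) := by
        ext ω
        by_cases hω : ω ∈ A <;> simp [hω]
      rw [this, auxG_sum G _ _ (fun i : Fin N => ((hu i).indicator hAm).smul (q i : ℝ))]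
      refine Finset.sum_congr rfl fun i _ => ?_
      rw [auxG_smul G _ ((hu i).indicator hAm), hA i A hAm, integral_const_mul]
    rw [e1]
    refine (le_abs_self _).trans ((auxG_le G (I2.indicator hAm)).trans ?_)
    simp_rw [norm_indicator_eq_indicator_norm]
    rw [integral_indicator hAm]
    exact mul_le_of_le_one_left (integral_nonneg fun _ => norm_nonneg _) hG
  have key2 := ae_all_iff.2 fun N => ae_all_iff.2 fun q => key N q
  filter_upwards [key2] with ω hω
  exact aux_helly (fun i => u i ω) (fun i => h i ω) hω

end

/-- sign of a bit -/
noncomputable def auxSgn (e : Bool) : ℝ := if e = true then 1 else -1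

theorem auxSgn_abs (e : Bool) : |auxSgn e| = 1 := by
  cases e <;> simp [auxSgn]

theorem auxSgn_mul (e : Bool) : auxSgn e * auxSgn e = 1 := by
  cases e <;> simp [auxSgn]

theorem auxSgn_meas : Measurable auxSgn := measurable_of_finite _

theorem aux_rademacher : ∃ P : Measure (ℕ → Bool), IsProbabilityMeasure P ∧
    (∀ i, ∫ d, auxSgn (d i) ∂P = 0) ∧
    ∀ (Φ : (ℕ → Bool) → ℝ) (K : ℝ), Measurable Φ → (∀ᵐ d ∂P, |Φ d| ≤ K) →
      Tendsto (fun i => ∫ d, auxSgn (d i) * Φ d ∂P) atTop (𝓝 0) := by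
  let coin : Measure Bool := (2⁻¹ : ENNReal) • (Measure.dirac true + Measure.dirac false)
  have hcoin : IsProbabilityMeasure coin := by
    constructor
    simp only [coin, Measure.smul_apply, Measure.add_apply, measure_univ, smul_eq_mul]
    rw [one_add_one_eq_two]
    exact ENNReal.inv_mul_cancel (by simp) (by simp)
  have hc0 : ∫ e, auxSgn e ∂coin = 0 := by
    simp only [coin]
    rw [integral_smul_measure, integral_add_measure]
    · simp [auxSgn]
    · exact integrable_dirac (by simp)
    · exact integrable_dirac (by simp)
  let P : Measure (ℕ → Bool) := Measure.infinitePi (fun _ : ℕ => coin)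
  have hP : IsProbabilityMeasure P := inferInstanceAs (IsProbabilityMeasure (Measure.infinitePi _))
  have hm : ∀ i : ℕ, Measurable (fun d : ℕ → Bool => auxSgn (d i)) :=
    fun i => auxSgn_meas.comp (measurable_pi_apply i)
  have h0 : ∀ i, ∫ d, auxSgn (d i) ∂P = 0 := by
    intro i
    rw [← hc0, ← (measurePreserving_eval_infinitePi (fun _ : ℕ => coin) i).map_eq,
      integral_map (measurable_pi_apply i).aemeasurable auxSgn_meas.aestronglyMeasurable]
  have hij : ∀ i j, i ≠ j → ∫ d, auxSgn (d i) * auxSgn (d j) ∂P = 0 := by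
    intro i j hne
    have hind := (ProbabilityTheory.iIndepFun_infinitePi (P := fun _ : ℕ => coin)
      (X := fun _ => auxSgn) (fun _ => auxSgn_meas)).indepFun hne
    have := hind.integral_fun_mul_eq_mul_integral (hm i).aestronglyMeasurable (hm j).aestronglyMeasurable
    rw [show (∫ d, auxSgn (d i) * auxSgn (d j) ∂P) = _ from this]
    rw [show (∫ d, auxSgn (d i) ∂(Measure.infinitePi (fun _ : ℕ => coin))) = 0 from h0 i, zero_mul]
  refine ⟨P, hP, h0, ?_⟩
  intro Φ K hΦ hK
  have hL : ∀ i : ℕ, MemLp (fun d : ℕ → Bool => auxSgn (d i)) 2 P := fun i =>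
    MemLp.of_bound (hm i).aestronglyMeasurable 1 (Eventually.of_forall fun d => (auxSgn_abs _).le)
  have hΦL : MemLp Φ 2 P := MemLp.of_bound hΦ.aestronglyMeasurable K hK
  have hinner : ∀ (u v : (ℕ → Bool) → ℝ) (hu : MemLp u 2 P) (hv : MemLp v 2 P),
      inner ℝ (hu.toLp u) (hv.toLp v) = ∫ d, u d * v d ∂P := by
    intro u v hu hv
    rw [L2.inner_def]
    refine integral_congr_ae ?_
    filter_upwards [hu.coeFn_toLp, hv.coeFn_toLp] with d h1 h2
    rw [h1, h2]
    simp [mul_comm]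
  have hon : Orthonormal ℝ (fun i => (hL i).toLp _) := by
    rw [orthonormal_iff_ite]
    intro i j
    rw [hinner]
    split_ifs with h
    · subst h
      simp [auxSgn_mul]
    · exact hij i j h
  have hs := (hon.inner_products_summable (x := hΦL.toLp Φ)).tendsto_atTop_zero
  simp only [hinner] at hs
  have h2 := hs.sqrt
  simp only [Real.sqrt_zero] at h2
  rw [tendsto_zero_iff_norm_tendsto_zero]
  refine h2.congr fun i => ?_
  rw [Real.sqrt_sq (norm_nonneg _)]

theorem aux_pointwise {X : Type*} [NormedAddCommGroup X] [NormedSpace ℝ X]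
    (P : Measure (ℕ → Bool)) [IsProbabilityMeasure P]
    (hrad : ∀ (Φ : (ℕ → Bool) → ℝ) (K : ℝ), Measurable Φ → (∀ᵐ d ∂P, |Φ d| ≤ K) →
      Tendsto (fun i => ∫ d, auxSgn (d i) * Φ d ∂P) atTop (𝓝 0))
    (ε : ℝ) (Fω : Set X) (hF : IsWeaklyPrecompactWith ε Fω)
    (x : ℕ → X) (hx : ∀ i, x i ∈ Fω) (h : ℕ → (ℕ → Bool) → ℝ) (hm : ∀ i, Measurable (h i))
    (hg : ∀ᵐ d ∂P, ∃ g : X →L[ℝ] ℝ, ‖g‖ ≤ 1 ∧ ∀ i, g (x i) = h i d) :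
    Tendsto (fun i => max ((∫ d, auxSgn (d i) * h i d ∂P) - ε) 0) atTop (𝓝 0) := by
  obtain ⟨K, hK⟩ := hF.1.exists_norm_le
  have hm' : ∀ i : ℕ, Measurable (fun d : ℕ → Bool => auxSgn (d i)) :=
    fun i => auxSgn_meas.comp (measurable_pi_apply i)
  refine tendsto_of_subseq_tendsto fun ns hns => ?_
  obtain ⟨φ, hφ, hδ⟩ := hF.2 (fun k => x (ns k)) (fun k => hx _)
  refine ⟨φ, ?_⟩
  have hns' : Tendsto (fun k => ns (φ k)) atTop atTop := hns.comp hφ.tendsto_atTop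
  set H : ℕ → (ℕ → Bool) → ℝ := fun k => h (ns (φ k)) with hH
  let Φ : (ℕ → Bool) → ℝ := fun d => limsup (fun k => H k d) atTop
  have hΦm : Measurable Φ := Measurable.limsup (fun k => hm _)
  have hbd : ∀ᵐ d ∂P, ∀ k, |H k d| ≤ K := by
    filter_upwards [hg] with d ⟨g, hg1, hg2⟩ k
    rw [hH]
    simp only
    rw [← hg2]
    calc ‖g (x (ns (φ k)))‖ ≤ ‖g‖ * ‖x (ns (φ k))‖ := g.le_opNorm _
      _ ≤ 1 * K := by gcongr; exact hK _ (hx _)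
      _ = K := one_mul _
  have hΦK : ∀ᵐ d ∂P, |Φ d| ≤ K := by
    filter_upwards [hbd] with d hd
    have hb1 : IsBoundedUnder (· ≤ ·) atTop (fun k => H k d) :=
      isBoundedUnder_of ⟨K, fun n => (abs_le.1 (hd n)).2⟩
    have hb2 : IsBoundedUnder (· ≥ ·) atTop (fun k => H k d) :=
      isBoundedUnder_of ⟨-K, fun n => (abs_le.1 (hd n)).1⟩
    rw [abs_le]
    constructor
    · exact le_limsup_of_frequently_le (Frequently.of_forall fun n => (abs_le.1 (hd n)).1) hb1
    · exact limsup_le_of_le hb2.isCoboundedUnder_le (Eventually.of_forall fun n => (abs_le.1 (hd n)).2)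
  have hlim : ∀ᵐ d ∂P, Tendsto (fun k => max (|H k d - Φ d| - ε) 0) atTop (𝓝 0) := by
    filter_upwards [hbd, hg] with d hd ⟨g, hg1, hg2⟩
    have hb1 : IsBoundedUnder (· ≤ ·) atTop (fun k => H k d) :=
      isBoundedUnder_of ⟨K, fun n => (abs_le.1 (hd n)).2⟩
    have hb2 : IsBoundedUnder (· ≥ ·) atTop (fun k => H k d) :=
      isBoundedUnder_of ⟨-K, fun n => (abs_le.1 (hd n)).1⟩
    have h1 := hδ g hg1
    simp only [hg2] at h1
    change Φ d - liminf (fun k => H k d) atTop ≤ ε at h1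
    have hli : liminf (fun k => H k d) atTop ≤ Φ d := liminf_le_limsup hb1 hb2
    rw [Metric.tendsto_atTop]
    intro η hη
    have e1 : ∀ᶠ k in atTop, H k d < Φ d + η := eventually_lt_of_limsup_lt
      (show limsup (fun k => H k d) atTop < Φ d + η from lt_add_of_pos_right _ hη) hb1
    have e2 : ∀ᶠ k in atTop, liminf (fun k => H k d) atTop - η < H k d :=
      eventually_lt_of_lt_liminf (sub_lt_self _ hη) hb2
    refine eventually_atTop.1 ?_
    filter_upwards [e1, e2] with k h2 h3
    rw [Real.dist_eq, sub_zero, abs_of_nonneg (le_max_right _ _)]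
    refine max_lt ?_ hη
    have : |H k d - Φ d| < ε + η := by
      rw [abs_lt]
      constructor <;> linarith
    linarith
  have hmeas : ∀ k, Measurable (fun d => max (|H k d - Φ d| - ε) 0) := fun k =>
    (((((hm _).sub hΦm).abs).sub_const ε)).max measurable_const
  have hdct : Tendsto (fun k => ∫ d, max (|H k d - Φ d| - ε) 0 ∂P) atTop (𝓝 (∫ _, (0:ℝ) ∂P)) := by
    refine tendsto_integral_of_dominated_convergence (fun _ => 2 * K + |ε|)
      (fun k => (hmeas k).aestronglyMeasurable) (integrable_const _) ?_ hlim
    intro k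
    filter_upwards [hbd, hΦK] with d h1 h2
    rw [Real.norm_eq_abs, abs_of_nonneg (le_max_right _ _)]
    have h3 : |H k d - Φ d| ≤ K + K := (abs_sub _ _).trans (add_le_add (h1 k) h2)
    have h4 := neg_abs_le ε
    have h5 := abs_nonneg (H k d - Φ d)
    have h6 := abs_nonneg ε
    refine max_le ?_ ?_ <;> linarith
  rw [integral_zero] at hdct
  have hr := (hrad Φ K hΦm hΦK).comp hns'
  have hsum := hdct.add hr.abs
  rw [abs_zero, add_zero] at hsum
  refine squeeze_zero (fun _ => le_max_right _ _) (fun k => ?_) hsum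
  simp only [Function.comp]
  have hpos : 0 ≤ ∫ d, max (|H k d - Φ d| - ε) 0 ∂P := integral_nonneg fun _ => le_max_right _ _
  refine max_le ?_ (add_nonneg hpos (abs_nonneg _))
  have bI : ∀ (f : (ℕ → Bool) → ℝ) (C : ℝ), Measurable f → (∀ᵐ d ∂P, |f d| ≤ C) → Integrable f P :=
    fun f C h1 h2 => Integrable.of_bound h1.aestronglyMeasurable C h2
  have i1 : Integrable (fun d => auxSgn (d (ns (φ k))) * Φ d) P := by
    refine bI _ K ((hm' _).mul hΦm) ?_
    filter_upwards [hΦK] with d h1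
    rwa [abs_mul, auxSgn_abs, one_mul]
  have i3 : Integrable (fun d => max (|H k d - Φ d| - ε) 0) P := by
    refine bI _ (2 * K + |ε|) (hmeas k) ?_
    filter_upwards [hbd, hΦK] with d h1 h2
    rw [abs_of_nonneg (le_max_right _ _)]
    have h3 : |H k d - Φ d| ≤ K + K := (abs_sub _ _).trans (add_le_add (h1 k) h2)
    have h4 := neg_abs_le ε
    have h5 := abs_nonneg (H k d - Φ d)
    have h6 := abs_nonneg ε
    refine max_le ?_ ?_ <;> linarith
  have i4 : Integrable (fun d => auxSgn (d (ns (φ k))) * H k d) P := by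
    refine bI _ K ((hm' _).mul (hm _)) ?_
    filter_upwards [hbd] with d h1
    rw [abs_mul, auxSgn_abs, one_mul]
    exact h1 k
  have hle : ∫ d, auxSgn (d (ns (φ k))) * H k d ∂P ≤
      ∫ d, (max (|H k d - Φ d| - ε) 0 + ε + auxSgn (d (ns (φ k))) * Φ d) ∂P := by
    refine integral_mono i4 ((i3.add (integrable_const ε)).add i1) fun d => ?_
    have h1 : auxSgn (d (ns (φ k))) * (H k d - Φ d) ≤ |H k d - Φ d| := by
      refine (le_abs_self _).trans_eq ?_
      rw [abs_mul, auxSgn_abs, one_mul]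
    have h2 := le_max_left (|H k d - Φ d| - ε) 0
    simp only
    nlinarith
  have i5 : Integrable (fun d => max (|H k d - Φ d| - ε) 0 + ε) P := i3.add (integrable_const ε)
  rw [integral_add i5 i1, integral_add i3 (integrable_const ε)] at hle
  simp only [integral_const, probReal_univ, one_smul] at hle
  have := le_abs_self (∫ d, auxSgn (d (ns (φ k))) * Φ d ∂P)
  change (∫ d, auxSgn (d (ns (φ k))) * H k d ∂P) - ε ≤ _
  linarith

theorem aux_toL1_sum {Ω X ι : Type*} [MeasurableSpace Ω] [NormedAddCommGroup X] [NormedSpace ℝ X]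
    {ν : Measure Ω} (t : Finset ι) (w : ι → ℝ) (v : ι → Ω → X) (hv : ∀ i, Integrable (v i) ν) :
    ∃ h : Integrable (∑ i ∈ t, w i • v i) ν,
      ∑ i ∈ t, w i • (hv i).toL1 (v i) = h.toL1 (∑ i ∈ t, w i • v i) := by
  classical
  refine ⟨integrable_finsetSum' _ fun i _ => (hv i).smul (w i), ?_⟩
  induction t using Finset.induction_on with
  | empty => simp only [Finset.sum_empty]; exact (Integrable.toL1_zero _).symm
  | insert a s ha ih =>
    simp only [Finset.sum_insert ha]
    rw [Integrable.toL1_add _ _ ((hv a).smul (w a))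
      (integrable_finsetSum' _ fun i _ => (hv i).smul (w i)), ← ih, Integrable.toL1_smul']

theorem aux_sgn_integrable {Ω X : Type*} [MeasurableSpace Ω] [NormedAddCommGroup X]
    [NormedSpace ℝ X] (μ : Measure Ω) [IsProbabilityMeasure μ]
    (P : Measure (ℕ → Bool)) [IsProbabilityMeasure P] (u : Ω × (ℕ → Bool) → X)
    (hu : Integrable u (μ.prod P)) (i : ℕ) :
    Integrable (fun p : Ω × (ℕ → Bool) => auxSgn (p.2 i) • u p) (μ.prod P) := by
  have hm : Measurable (fun p : Ω × (ℕ → Bool) => auxSgn (p.2 i)) :=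
    auxSgn_meas.comp ((measurable_pi_apply i).comp measurable_snd)
  refine Integrable.mono hu (hm.aestronglyMeasurable.smul hu.aestronglyMeasurable)
    (Eventually.of_forall fun p => ?_)
  rw [norm_smul, Real.norm_eq_abs, auxSgn_abs, one_mul]

theorem aux_functional {Ω X : Type*} [MeasurableSpace Ω] [NormedAddCommGroup X] [NormedSpace ℝ X]
    (μ : Measure Ω) [IsProbabilityMeasure μ]
    (P : Measure (ℕ → Bool)) [IsProbabilityMeasure P] (h0 : ∀ i, ∫ d, auxSgn (d i) ∂P = 0)
    (f : ℕ → Lp X 1 μ) (a b : ℝ) (hab : a < b)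
    (hind : ∀ (N : ℕ) (d : ℕ → Bool),
      ∃ g : Lp X 1 μ →L[ℝ] ℝ, ‖g‖ ≤ 1 ∧ ∀ k < N, (d k = true → b < g (f k)) ∧
        (d k = false → g (f k) < a)) :
    ∃ G : Lp X 1 (μ.prod P) →L[ℝ] ℝ, ‖G‖ ≤ 1 ∧
      ∀ i, (b - a) / 2 ≤ auxG G (fun p => auxSgn (p.2 i) • f i p.1) := by
  have hfi : ∀ i, Integrable (f i) μ := fun i => L1.integrable_coeFn (f i)
  have hv : ∀ i, Integrable (fun p : Ω × (ℕ → Bool) => auxSgn (p.2 i) • f i p.1) (μ.prod P) :=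
    fun i => aux_sgn_integrable μ P _ ((hfi i).comp_fst P) i
  set v : ℕ → Ω × (ℕ → Bool) → X := fun i p => auxSgn (p.2 i) • f i p.1 with hvdef
  let V : ℕ → Lp X 1 (μ.prod P) := fun i => (hv i).toL1 (v i)
  set c := (b - a) / 2 with hc
  have hcpos : 0 < c := by rw [hc]; linarith
  have hmS : ∀ i : ℕ, Integrable (fun d : ℕ → Bool => auxSgn (d i)) P := fun i =>
    Integrable.of_bound (auxSgn_meas.comp (measurable_pi_apply i)).aestronglyMeasurable 1
      (Eventually.of_forall fun d => (auxSgn_abs _).le)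
  have hlow : ∀ y ∈ convexHull ℝ (Set.range V), c ≤ ‖y‖ := by
    intro y hy
    rw [convexHull_eq] at hy
    obtain ⟨ι, t, w, z, hw, hw1, hz, rfl⟩ := hy
    rw [Finset.centerMass_eq_of_sum_1 _ _ hw1]
    have hk : ∀ i : ι, ∃ k, i ∈ t → V k = z i := by
      intro i
      by_cases hi : i ∈ t
      · obtain ⟨k, hk⟩ := hz i hi
        exact ⟨k, fun _ => hk⟩
      · exact ⟨0, fun h => absurd h hi⟩
    choose k hk using hk
    have e1 : ∑ i ∈ t, w i • z i = ∑ i ∈ t, w i • (hv (k i)).toL1 (v (k i)) :=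
      Finset.sum_congr rfl fun i hi => by rw [← hk i hi]
    obtain ⟨hI, e2⟩ := aux_toL1_sum t w (fun i => v (k i)) (fun i => hv (k i))
    rw [e1, e2, L1.norm_of_fun_eq_integral_norm, integral_prod_symm _ hI.norm]
    have hI2 : Integrable (fun d => ∑ i ∈ t, w i * (c + auxSgn (d (k i)) * ((a + b) / 2))) P :=
      integrable_finsetSum _ fun i _ =>
        (((integrable_const c).add ((hmS (k i)).mul_const _))).const_mul _
    have hval : ∫ d, ∑ i ∈ t, w i * (c + auxSgn (d (k i)) * ((a + b) / 2)) ∂P = c := by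
      have hI3 : ∀ i ∈ t, Integrable (fun d => w i * (c + auxSgn (d (k i)) * ((a + b) / 2))) P :=
        fun i _ => (((integrable_const c).add ((hmS (k i)).mul_const _))).const_mul _
      rw [integral_finsetSum _ hI3]
      have : ∀ i ∈ t, ∫ d, w i * (c + auxSgn (d (k i)) * ((a + b) / 2)) ∂P = w i * c := by
        intro i _
        rw [integral_const_mul, integral_add (integrable_const c) ((hmS (k i)).mul_const _),
          integral_mul_const, h0]
        simp
      rw [Finset.sum_congr rfl this, ← Finset.sum_mul, hw1, one_mul]
    rw [← hval]
    refine integral_mono hI2 hI.norm.integral_prod_right fun d => ?_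
    obtain ⟨g, hg1, hg⟩ := hind (t.sup k + 1) d
    obtain ⟨hJ, e3⟩ := aux_toL1_sum t (fun i => w i * auxSgn (d (k i))) (fun i => f (k i))
      (fun i => hfi (k i))
    have e4 : ∫ ω, ‖(∑ i ∈ t, w i • v (k i)) (ω, d)‖ ∂μ
        = ‖∑ i ∈ t, (w i * auxSgn (d (k i))) • f (k i)‖ := by
      have : ∀ i, (hfi (k i)).toL1 (f (k i)) = f (k i) := fun i => Integrable.toL1_coeFn _ _
      simp only [this] at e3
      rw [e3, L1.norm_of_fun_eq_integral_norm]
      simp only [Finset.sum_apply, Pi.smul_apply, hvdef, smul_smul]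
    simp only
    rw [e4]
    calc ∑ i ∈ t, w i * (c + auxSgn (d (k i)) * ((a + b) / 2))
        ≤ ∑ i ∈ t, (w i * auxSgn (d (k i))) * g (f (k i)) := by
          refine Finset.sum_le_sum fun i hi => ?_
          rw [mul_assoc]
          refine mul_le_mul_of_nonneg_left ?_ (hw i hi)
          have hlt := hg (k i) (Nat.lt_succ_of_le (Finset.le_sup hi))
          cases hd : d (k i) with
          | true =>
            have := hlt.1 hd
            simp only [auxSgn, if_true]
            linarith
          | false =>
            have := hlt.2 hd
            simp only [auxSgn, Bool.false_eq_true, if_false]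
            linarith
      _ = g (∑ i ∈ t, (w i * auxSgn (d (k i))) • f (k i)) := by
          rw [map_sum]
          simp only [map_smul, smul_eq_mul]
      _ ≤ ‖g‖ * ‖∑ i ∈ t, (w i * auxSgn (d (k i))) • f (k i)‖ :=
          (le_abs_self _).trans (g.le_opNorm _)
      _ ≤ _ := mul_le_of_le_one_left (norm_nonneg _) hg1
  obtain ⟨G, s, hG1, hG2⟩ := geometric_hahn_banach_open (convex_ball (0 : Lp X 1 (μ.prod P)) c)
    Metric.isOpen_ball (convex_convexHull ℝ (Set.range V)) (by
      rw [Set.disjoint_left]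
      intro y hy hy2
      have := hlow y hy2
      rw [mem_ball_zero_iff] at hy
      linarith)
  have hs : 0 < s := by simpa using hG1 0 (Metric.mem_ball_self hcpos)
  have hGn : ‖G‖ ≤ s / c := by
    refine ContinuousLinearMap.opNorm_bound_of_ball_bound hcpos s G ?_
    have hcl : Metric.closedBall (0 : Lp X 1 (μ.prod P)) c ⊆ {z | ‖G z‖ ≤ s} := by
      rw [← closure_ball _ hcpos.ne']
      refine closure_minimal ?_ (isClosed_le (by fun_prop) (by fun_prop))
      intro z hz
      have h1 := hG1 z hz
      have h2 := hG1 (-z) (by simpa using hz)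
      rw [map_neg] at h2
      exact abs_le.2 ⟨by linarith, h1.le⟩
    exact fun z hz => hcl hz
  refine ⟨(c / s) • G, ?_, fun i => ?_⟩
  · rw [norm_smul, Real.norm_of_nonneg (by positivity)]
    calc c / s * ‖G‖ ≤ c / s * (s / c) := by gcongr
      _ = 1 := by field_simp
  · rw [auxG_eq _ (hv i)]
    have := hG2 (V i) (subset_convexHull _ _ ⟨i, rfl⟩)
    change c ≤ c / s * G (V i)
    calc c = c / s * s := by field_simp
      _ ≤ _ := by gcongr

theorem unifIntegrable_selectors_weaklyPrecompact
    {Ω X : Type*} [MeasurableSpace Ω] [NormedAddCommGroup X] [NormedSpace ℝ X]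
    [CompleteSpace X]
    (μ : Measure Ω) [IsProbabilityMeasure μ] (ε : ℝ) (hε : 0 ≤ ε)
    (F : Ω → Set X) (hF : ∀ᵐ ω ∂μ, IsWeaklyPrecompactWith ε (F ω))
    (W : Set (Lp X 1 μ)) (hW : ∀ f ∈ W, ∀ᵐ ω ∂μ, f ω ∈ F ω)
    (hui : UnifIntegrableSet μ W) :
    IsWeaklyPrecompactWith (2 * ε) W := by
  refine ⟨hui.1, fun x hx => ?_⟩
  by_contra hcon
  push Not at hcon
  obtain ⟨C, hC⟩ := hui.1.exists_norm_le
  obtain ⟨n, hn, a, b, hab, hind⟩ := aux_rosenthal x C (fun k => hC _ (hx k)) (2 * ε) hcon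
  obtain ⟨P, hP, h0, hrad⟩ := aux_rademacher
  set f : ℕ → Lp X 1 μ := fun k => x (n k) with hf
  have hfW : ∀ k, f k ∈ W := fun k => hx _
  obtain ⟨G, hG1, hG⟩ := aux_functional μ P h0 f a b (by linarith) hind
  have hfi : ∀ i, Integrable (f i) μ := fun i => L1.integrable_coeFn (f i)
  have hu : ∀ i, Integrable (fun p : Ω × (ℕ → Bool) => f i p.1) (μ.prod P) :=
    fun i => (hfi i).comp_fst P
  obtain ⟨h, hm, hi, hA, hg⟩ := aux_density_seq G hG1 (fun i p => f i p.1) hu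
  have hsh : ∀ i, Integrable (fun p : Ω × (ℕ → Bool) => auxSgn (p.2 i) * h i p) (μ.prod P) :=
    fun i => aux_sgn_integrable μ P _ (hi i) i
  have hGh : ∀ i, (b - a) / 2 ≤ ∫ p, auxSgn (p.2 i) * h i p ∂(μ.prod P) := by
    intro i
    refine (hG i).trans_eq ?_
    let A : Set (Ω × (ℕ → Bool)) := {p | p.2 i = true}
    have hmi : Measurable (fun p : Ω × (ℕ → Bool) => p.2 i) :=
      (measurable_pi_apply i).comp measurable_snd
    have hAm : MeasurableSet A := measurableSet_eq_fun hmi measurable_const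
    have e1 : (fun p : Ω × (ℕ → Bool) => auxSgn (p.2 i) • f i p.1)
        = A.indicator (fun p => f i p.1) - Aᶜ.indicator (fun p => f i p.1) := by
      ext p
      by_cases hp : p.2 i = true <;> simp [A, hp, auxSgn]
    rw [e1, auxG_sub G ((hu i).indicator hAm) ((hu i).indicator hAm.compl), hA i A hAm,
      hA i _ hAm.compl, ← integral_add_compl hAm (hsh i), sub_eq_add_neg, ← integral_neg]
    congr 1
    · refine setIntegral_congr_fun hAm fun p hp => ?_
      have hp' : p.2 i = true := hp
      simp [auxSgn, hp']
    · refine setIntegral_congr_fun hAm.compl fun p hp => ?_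
      have hp' : ¬ p.2 i = true := hp
      simp [auxSgn, hp']
  let J : ℕ → Ω → ℝ := fun i ω => ∫ d, auxSgn (d i) * h i (ω, d) ∂P
  have hJi : ∀ i, Integrable (J i) μ := fun i => (hsh i).integral_prod_left
  have hJ : ∀ i, (b - a) / 2 ≤ ∫ ω, J i ω ∂μ := by
    intro i
    refine (hGh i).trans_eq ?_
    rw [integral_prod _ (hsh i)]
  have hg' := Measure.ae_ae_of_ae_prod hg
  have hJle : ∀ᵐ ω ∂μ, ∀ i, |J i ω| ≤ ‖f i ω‖ := by
    filter_upwards [hg'] with ω hω i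
    have := norm_integral_le_of_norm_le_const (μ := P) (C := ‖f i ω‖)
      (f := fun d => auxSgn (d i) * h i (ω, d)) (by
        filter_upwards [hω] with d ⟨g, hg1, hg2⟩
        rw [Real.norm_eq_abs, abs_mul, auxSgn_abs, one_mul, ← hg2 i]
        calc ‖g (f i ω)‖ ≤ ‖g‖ * ‖f i ω‖ := g.le_opNorm _
          _ ≤ ‖f i ω‖ := mul_le_of_le_one_left (norm_nonneg _) hg1)
    simpa using this
  have hFmem : ∀ᵐ ω ∂μ, ∀ i, f i ω ∈ F ω := ae_all_iff.2 fun i => hW _ (hfW i)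
  let j : ℕ → Ω → ℝ := fun i ω => max (J i ω - ε) 0
  have hji : ∀ i, Integrable (j i) μ := fun i => ((hJi i).sub (integrable_const ε)).sup (integrable_zero _ _ _)
  have hjlim : ∀ᵐ ω ∂μ, Tendsto (fun i => j i ω) atTop (𝓝 ((0 : Ω → ℝ) ω)) := by
    filter_upwards [hg', hFmem, hF] with ω h1 h2 h3
    exact aux_pointwise P hrad ε (F ω) h3 (fun i => f i ω) h2 (fun i d => h i (ω, d))
      (fun i => (hm i).comp measurable_prodMk_left) h1
  have hjui : UnifIntegrable j 1 μ := by
    intro η hη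
    obtain ⟨δ, hδ, hδ'⟩ := hui.2 η hη
    refine ⟨δ, hδ, fun i s hs hμs => ?_⟩
    have h1 := hδ' (f i) (hfW i) s hs hμs
    calc eLpNorm (s.indicator (j i)) 1 μ ≤ eLpNorm (s.indicator (f i)) 1 μ := by
          refine eLpNorm_mono_ae ?_
          filter_upwards [hJle] with ω hω
          by_cases hωs : ω ∈ s
          · simp only [hωs, Set.indicator_of_mem]
            refine le_trans ?_ (hω i)
            rw [Real.norm_eq_abs, abs_of_nonneg (le_max_right _ _)]
            refine max_le ?_ (abs_nonneg _)
            have := le_abs_self (J i ω)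
            linarith
          · simp [hωs]
      _ = ENNReal.ofReal (∫ ω in s, ‖f i ω‖ ∂μ) := by
          rw [eLpNorm_indicator_eq_eLpNorm_restrict hs, eLpNorm_one_eq_lintegral_enorm,
            ofReal_integral_norm_eq_lintegral_enorm (hfi i).integrableOn]
      _ ≤ ENNReal.ofReal η := ENNReal.ofReal_le_ofReal h1
  have hlim := tendsto_Lp_finite_of_tendsto_ae le_rfl ENNReal.one_ne_top
    (fun i => (hji i).aestronglyMeasurable) (MemLp.zero (p := 1)) hjui hjlim
  have hpos : 0 < ENNReal.ofReal ((b - a) / 2 - ε) := by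
    rw [ENNReal.ofReal_pos]
    linarith
  obtain ⟨i, hi'⟩ := (hlim.eventually_lt_const hpos).exists
  rw [sub_zero, eLpNorm_one_eq_lintegral_enorm, ← ofReal_integral_norm_eq_lintegral_enorm (hji i)] at hi'
  have h1 := (ENNReal.ofReal_lt_ofReal_iff (by linarith)).1 hi'
  have h2 : ∫ ω, J i ω ∂μ ≤ ∫ ω, (‖j i ω‖ + ε) ∂μ := by
    refine integral_mono (hJi i) ((hji i).norm.add (integrable_const ε)) fun ω => ?_
    have h3 := le_max_left (J i ω - ε) 0
    have h4 := Real.le_norm_self (j i ω)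
    change J i ω ≤ ‖j i ω‖ + ε
    change J i ω - ε ≤ j i ω at h3
    linarith
  rw [integral_add (hji i).norm (integrable_const ε)] at h2
  simp only [integral_const, probReal_univ, one_smul] at h2
  have := hJ i
  linarith
end
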